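/- arXiv:1707.01622 — 2 statements merged into one kernel-verified Lean document; each statement's English description precedes it below -/
import Mathlib

section
/- Let K be a number field of degree m, ρ the residue of ζ_K at s = 1, and γ_n(K) the coefficient of (s−1)^n in the Laurent expansion of ζ_K at s = 1. Then for n ≥ 1, γ_n(K) = ((−1)^n/n!) · lim_{x→∞} (∑_{N𝔞 ≤ x} (log N𝔞)^n / N𝔞 − ρ (log x)^{n+1}/(n+1)). -/
open Filter NumberField

theorem ds_hasSum_congr {f g : ℕ → ℝ} {a b : ℝ} (h : HasSum f a) (hf : ∀ n, g n = f n)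
    (hab : b = a) : HasSum g b := by
  rw [hab, funext hf]
  exact h

theorem ds_coeff_eq (a b : ℕ → ℝ) (f g : ℝ → ℝ) (r : ℝ) (hr : 0 < r)
    (ha : ∀ x, |x| < r → HasSum (fun n => a n * x ^ n) (f x))
    (hb : ∀ x, |x| < r → HasSum (fun n => b n * x ^ n) (g x))
    (hfg : ∀ x, 0 < x → x < r → f x = g x) : a = b := by
  have key : ∀ (a : ℕ → ℝ) (f : ℝ → ℝ), (∀ x, |x| < r → HasSum (fun n => a n * x ^ n) (f x)) →
      HasFPowerSeriesAt f (FormalMultilinearSeries.ofScalars ℝ a) 0 := by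
    intro a f h
    rw [hasFPowerSeriesAt_iff]
    filter_upwards [Metric.ball_mem_nhds (0 : ℝ) hr] with z hz
    have hz' : |z| < r := by simpa using hz
    simpa [FormalMultilinearSeries.coeff_ofScalars, mul_comm] using h z hz'
  have h1 := key a f ha
  have h2 := key b g hb
  have h3 : ∀ᶠ z in nhds 0, f z = g z := by
    rw [← AnalyticAt.frequently_eq_iff_eventually_eq h1.analyticAt h2.analyticAt]
    have : ∃ᶠ z in nhdsWithin (0 : ℝ) (Set.Ioi 0), f z = g z := by
      apply Eventually.frequently
      filter_upwards [Ioo_mem_nhdsGT hr] with z hz using hfg z hz.1 hz.2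
    exact this.filter_mono (nhdsWithin_mono _ (fun x hx => ne_of_gt hx))
  have h4 := h1.eq_formalMultilinearSeries_of_eventually h2 h3
  ext n
  have := congrArg (fun p => p.coeff n) h4
  simpa [FormalMultilinearSeries.coeff_ofScalars] using this

theorem ds_expand (E : ℝ → ℝ) (hE : Measurable E) (C δ : ℝ) (hδ : 0 < δ)
    (hb : ∀ t, 1 ≤ t → |E t| ≤ C * t ^ (1 - δ)) (x : ℝ) (hx : |x| < δ) :
    HasSum (fun j : ℕ => ((-1) ^ j / (j.factorial : ℝ) *
      ∫ t in Set.Ioi (1 : ℝ), E t * (Real.log t ^ j / t ^ 2)) * x ^ j)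
      (∫ t in Set.Ioi (1 : ℝ), E t * t ^ (-(2 + x))) := by
  have hexp : ∀ t y : ℝ, 1 < t → HasSum (fun j : ℕ => (y * Real.log t) ^ j / (j.factorial : ℝ))
      (t ^ y) := by
    intro t y ht
    rw [Real.rpow_def_of_pos (by linarith), mul_comm, Real.exp_eq_exp_ℝ]
    exact NormedSpace.expSeries_div_hasSum_exp _
  have hbs : ∀ t : ℝ, 1 < t → HasSum (fun j : ℕ => C * t ^ (-1 - δ) *
      ((|x| * Real.log t) ^ j / (j.factorial : ℝ))) (C * t ^ (-1 - δ + |x|)) := by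
    intro t ht
    rw [Real.rpow_add (by linarith), ← mul_assoc]
    exact (hexp t |x| ht).mul_left _
  have := MeasureTheory.hasSum_integral_of_dominated_convergence
    (μ := MeasureTheory.volume.restrict (Set.Ioi (1 : ℝ)))
    (F := fun (j : ℕ) t => (-1) ^ j / (j.factorial : ℝ) * (E t * (Real.log t ^ j / t ^ 2)) * x ^ j)
    (f := fun t => E t * t ^ (-(2 + x)))
    (fun (j : ℕ) t => C * t ^ (-1 - δ) * ((|x| * Real.log t) ^ j / (j.factorial : ℝ)))
    (fun j => by
      apply Measurable.aestronglyMeasurable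
      fun_prop)
    (fun j => by
      refine (MeasureTheory.ae_restrict_iff' measurableSet_Ioi).2 (Eventually.of_forall ?_)
      intro t ht
      have ht : 1 < t := ht
      have hl := Real.log_nonneg ht.le
      have h2 : t ^ (1 - δ) = t ^ (-1 - δ) * t ^ 2 := by
        rw [← Real.rpow_natCast, ← Real.rpow_add (by linarith)]
        congr 1; push_cast; ring
      have h1 := hb t ht.le
      rw [h2] at h1
      have ht2 : 0 < t ^ 2 := by positivity
      have h3 : |E t| / t ^ 2 ≤ C * t ^ (-1 - δ) := by
        rw [div_le_iff₀ ht2]; linarith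
      calc ‖(-1) ^ j / (j.factorial : ℝ) * (E t * (Real.log t ^ j / t ^ 2)) * x ^ j‖
          = |E t| / t ^ 2 * ((|x| * Real.log t) ^ j / (j.factorial : ℝ)) := by
            simp only [norm_mul, norm_div, norm_pow, Real.norm_eq_abs, abs_neg, abs_one, one_pow,
              abs_of_nonneg hl, Nat.abs_cast, abs_of_pos (show (0:ℝ) < t by linarith)]
            ring
        _ ≤ _ := by gcongr)
    ((MeasureTheory.ae_restrict_iff' measurableSet_Ioi).2 (Eventually.of_forall
      fun t ht => (hbs t ht).summable))
    (by
      have : MeasureTheory.IntegrableOn (fun t : ℝ => C * t ^ (-1 - δ + |x|)) (Set.Ioi 1) :=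
        (integrableOn_Ioi_rpow_of_lt (by linarith) one_pos).const_mul _
      refine MeasureTheory.IntegrableOn.congr_fun this ?_ measurableSet_Ioi
      intro t ht
      exact (hbs t ht).tsum_eq.symm)
    ((MeasureTheory.ae_restrict_iff' measurableSet_Ioi).2 (Eventually.of_forall (by
      intro t ht
      have ht : 1 < t := ht
      have h := (hexp t (-x) ht).mul_left (E t / t ^ 2)
      have e : E t * t ^ (-(2 + x)) = E t / t ^ 2 * t ^ (-x) := by
        rw [neg_add, Real.rpow_add (by linarith), Real.rpow_neg (by linarith)]
        norm_num
        ring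
      rw [e]
      refine ds_hasSum_congr h (fun j => ?_) rfl
      rw [neg_mul, neg_pow (x * Real.log t), mul_pow]
      ring)))
  refine ds_hasSum_congr this (fun j => ?_) rfl
  rw [← MeasureTheory.integral_const_mul, ← MeasureTheory.integral_mul_const]

theorem ds_integrable (E : ℝ → ℝ) (hE : Measurable E) (C δ : ℝ) (hδ : 0 < δ)
    (hb : ∀ t, 1 ≤ t → |E t| ≤ C * t ^ (1 - δ)) (j : ℕ) :
    MeasureTheory.IntegrableOn (fun t => E t * (Real.log t ^ j / t ^ 2)) (Set.Ioi 1) := by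
  have hi : MeasureTheory.IntegrableOn
      (fun t : ℝ => C * (j.factorial : ℝ) / (δ / 2) ^ j * t ^ (-1 - δ / 2)) (Set.Ioi 1) :=
    (integrableOn_Ioi_rpow_of_lt (by linarith) one_pos).const_mul _
  refine MeasureTheory.Integrable.mono' hi ?_ ?_
  · apply Measurable.aestronglyMeasurable
    fun_prop
  refine (MeasureTheory.ae_restrict_iff' measurableSet_Ioi).2 (Eventually.of_forall ?_)
  intro t ht
  have ht : 1 < t := ht
  have ht0 : 0 < t := by linarith
  have hl := Real.log_nonneg ht.le
  have h2 : t ^ (1 - δ) = t ^ (-1 - δ / 2) * t ^ 2 / t ^ (δ / 2) := by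
    rw [← Real.rpow_natCast, ← Real.rpow_add ht0, ← Real.rpow_sub ht0]
    congr 1; push_cast; ring
  have h1 := hb t ht.le
  have h4 : Real.log t ^ j ≤ (j.factorial : ℝ) / (δ / 2) ^ j * t ^ (δ / 2) := by
    have := Real.pow_div_factorial_le_exp (δ / 2 * Real.log t) (by positivity) j
    rw [mul_comm (δ / 2), ← Real.rpow_def_of_pos ht0, div_le_iff₀ (by positivity), mul_pow] at this
    rw [div_mul_eq_mul_div, le_div_iff₀ (by positivity)]
    linarith
  have hp : 0 < t ^ (δ / 2) := by positivity
  calc ‖E t * (Real.log t ^ j / t ^ 2)‖ = |E t| * (Real.log t ^ j / t ^ 2) := by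
        rw [norm_mul, Real.norm_eq_abs, Real.norm_of_nonneg (by positivity)]
    _ ≤ (C * t ^ (1 - δ)) * (((j.factorial : ℝ) / (δ / 2) ^ j * t ^ (δ / 2)) / t ^ 2) := by
        gcongr
        exact (abs_nonneg _).trans h1
    _ = _ := by rw [h2]; field_simp

theorem ds_tendsto_zero (E : ℝ → ℝ) (C δ : ℝ) (hδ : 0 < δ)
    (hb : ∀ t, 1 ≤ t → |E t| ≤ C * t ^ (1 - δ)) (j : ℕ) :
    Tendsto (fun t => Real.log t ^ j / t * E t) atTop (nhds 0) := by
  have h : Tendsto (fun t : ℝ => C * (Real.log t ^ (j : ℝ) / t ^ δ)) atTop (nhds (C * 0)) :=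
    ((isLittleO_log_rpow_rpow_atTop (j : ℝ) hδ).tendsto_div_nhds_zero).const_mul C
  rw [mul_zero] at h
  refine squeeze_zero_norm' ?_ h
  filter_upwards [eventually_gt_atTop 1] with t ht
  have ht0 : 0 < t := by linarith
  have hl := Real.log_nonneg ht.le
  have h1 := hb t ht.le
  rw [Real.rpow_sub ht0, Real.rpow_one] at h1
  rw [Real.rpow_natCast, norm_mul, Real.norm_of_nonneg (by positivity), Real.norm_eq_abs]
  calc Real.log t ^ j / t * |E t| ≤ Real.log t ^ j / t * (C * (t / t ^ δ)) := by gcongr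
    _ = _ := by field_simp

theorem ds_abel (a : ℕ → ℝ) (ha : a 0 = 0) (ρ : ℝ) (n : ℕ) (hn : 1 ≤ n) (x : ℝ) (hx : 1 ≤ x) :
    (∑ k ∈ Finset.Icc 1 ⌊x⌋₊, a k * Real.log k ^ n / k) - ρ * Real.log x ^ (n + 1) / (n + 1)
      = Real.log x ^ n / x * ((∑ k ∈ Finset.Icc 1 ⌊x⌋₊, a k) - ρ * x) +
        ∫ t in (1 : ℝ)..x, ((∑ k ∈ Finset.Icc 1 ⌊t⌋₊, a k) - ρ * t) *
          (Real.log t ^ n / t ^ 2) - n * (((∑ k ∈ Finset.Icc 1 ⌊t⌋₊, a k) - ρ * t) *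
          (Real.log t ^ (n - 1) / t ^ 2)) := by
  obtain ⟨m, rfl⟩ : ∃ m, n = m + 1 := ⟨n - 1, by omega⟩
  have h4 : ∀ (f : ℕ → ℝ), f 0 = 0 → ∀ n, ∑ k ∈ Finset.Icc 0 n, f k = ∑ k ∈ Finset.Icc 1 n, f k := by
    intro f hf n
    rw [← Finset.insert_Icc_add_one_left_eq_Icc n.zero_le, Finset.sum_insert (by simp), hf]
    simp
  have hd : ∀ t : ℝ, 1 ≤ t → HasDerivAt (fun t => Real.log t ^ (m + 1) / t)
      (((m + 1 : ℕ) : ℝ) * Real.log t ^ m / t ^ 2 - Real.log t ^ (m + 1) / t ^ 2) t := by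
    intro t ht
    have ht0 : t ≠ 0 := by positivity
    have := ((Real.hasDerivAt_log ht0).pow (m + 1)).div (hasDerivAt_id t) ht0
    refine this.congr_deriv ?_
    simp
    field_simp
  have hcont : ContinuousOn (fun t : ℝ => ((m + 1 : ℕ) : ℝ) * Real.log t ^ m / t ^ 2
      - Real.log t ^ (m + 1) / t ^ 2) (Set.Icc 1 x) := by
    have : ∀ t ∈ Set.Icc 1 x, t ≠ 0 := fun t ht => by have := ht.1; positivity
    have h2 : ∀ t ∈ Set.Icc 1 x, t ^ 2 ≠ 0 := fun t ht => by have := ht.1; positivity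
    fun_prop (disch := assumption)
  have hint : MeasureTheory.IntegrableOn (deriv (fun t : ℝ => Real.log t ^ (m + 1) / t))
      (Set.Icc 1 x) := by
    refine (hcont.integrableOn_Icc).congr_fun ?_ measurableSet_Icc
    intro t ht
    exact (hd t ht.1).deriv.symm
  have habel := sum_mul_eq_sub_integral_mul₀ (f := fun t : ℝ => Real.log t ^ (m + 1) / t) a ha x
    (fun t ht => (hd t ht.1).differentiableAt) hint
  rw [← intervalIntegral.integral_of_le hx, h4 a ha, h4 _ (by simp)] at habel
  have hftc : ∫ t in (1 : ℝ)..x, (((m + 1 : ℕ) : ℝ) * Real.log t ^ m / t ^ 2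
      - Real.log t ^ (m + 1) / t ^ 2) * (ρ * t) =
      ρ * (Real.log x ^ (m + 1) - Real.log x ^ (m + 2) / ((m + 2 : ℕ) : ℝ)) := by
    rw [intervalIntegral.integral_eq_sub_of_hasDerivAt
      (f := fun t => ρ * (Real.log t ^ (m + 1) - Real.log t ^ (m + 2) / ((m + 2 : ℕ) : ℝ)))]
    · simp
    · intro t ht
      rw [Set.uIcc_of_le hx] at ht
      have ht0 : t ≠ 0 := by have := ht.1; positivity
      have := (((Real.hasDerivAt_log ht0).pow (m + 1)).sub
        (((Real.hasDerivAt_log ht0).pow (m + 2)).div_const ((m + 2 : ℕ) : ℝ))).const_mul ρ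
      refine this.congr_deriv ?_
      simp only [Nat.add_sub_cancel, show m + 2 - 1 = m + 1 from rfl]
      have : ((m + 2 : ℕ) : ℝ) ≠ 0 := by positivity
      field_simp
    · refine ContinuousOn.intervalIntegrable ?_
      rw [Set.uIcc_of_le hx]
      exact hcont.mul (by fun_prop)
  have hA : IntervalIntegrable (fun t => (((m + 1 : ℕ) : ℝ) * Real.log t ^ m / t ^ 2
      - Real.log t ^ (m + 1) / t ^ 2) * ∑ k ∈ Finset.Icc 1 ⌊t⌋₊, a k) MeasureTheory.volume 1 x := by
    rw [intervalIntegrable_iff_integrableOn_Icc_of_le hx]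
    exact integrableOn_mul_sum_Icc a zero_le_one hcont.integrableOn_Icc
  have hB : IntervalIntegrable (fun t => (((m + 1 : ℕ) : ℝ) * Real.log t ^ m / t ^ 2
      - Real.log t ^ (m + 1) / t ^ 2) * (ρ * t)) MeasureTheory.volume 1 x := by
    refine ContinuousOn.intervalIntegrable ?_
    rw [Set.uIcc_of_le hx]
    exact hcont.mul (by fun_prop)
  have e1 : ∫ t in (1 : ℝ)..x, deriv (fun t : ℝ => Real.log t ^ (m + 1) / t) t *
        ∑ k ∈ Finset.Icc 0 ⌊t⌋₊, a k = ∫ t in (1 : ℝ)..x, (((m + 1 : ℕ) : ℝ) * Real.log t ^ m / t ^ 2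
      - Real.log t ^ (m + 1) / t ^ 2) * ∑ k ∈ Finset.Icc 1 ⌊t⌋₊, a k := by
    refine intervalIntegral.integral_congr ?_
    intro t ht
    rw [Set.uIcc_of_le hx] at ht
    simp only [h4 a ha, (hd t ht.1).deriv]
  have e2 : ∫ t in (1 : ℝ)..x, ((∑ k ∈ Finset.Icc 1 ⌊t⌋₊, a k) - ρ * t) *
          (Real.log t ^ (m + 1) / t ^ 2) - (m + 1 : ℕ) * (((∑ k ∈ Finset.Icc 1 ⌊t⌋₊, a k) - ρ * t) *
          (Real.log t ^ (m + 1 - 1) / t ^ 2)) =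
      (∫ t in (1 : ℝ)..x, (((m + 1 : ℕ) : ℝ) * Real.log t ^ m / t ^ 2
      - Real.log t ^ (m + 1) / t ^ 2) * (ρ * t)) - ∫ t in (1 : ℝ)..x,
        (((m + 1 : ℕ) : ℝ) * Real.log t ^ m / t ^ 2
      - Real.log t ^ (m + 1) / t ^ 2) * ∑ k ∈ Finset.Icc 1 ⌊t⌋₊, a k := by
    rw [← intervalIntegral.integral_sub hB hA]
    congr 1
    ext t
    simp only [Nat.add_sub_cancel]
    ring
  rw [e2, hftc, ← e1]
  have e3 : ∑ k ∈ Finset.Icc 1 ⌊x⌋₊, a k * Real.log k ^ (m + 1) / k =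
      ∑ k ∈ Finset.Icc 1 ⌊x⌋₊, Real.log k ^ (m + 1) / k * a k :=
    Finset.sum_congr rfl fun k _ => by ring
  rw [e3, habel]
  have : x ≠ 0 := by positivity
  push_cast
  field_simp
  ring

theorem ds_limit (a : ℕ → ℝ) (ha : a 0 = 0) (ρ C δ : ℝ) (hδ : 0 < δ)
    (hb : ∀ t : ℝ, 1 ≤ t → |(∑ k ∈ Finset.Icc 1 ⌊t⌋₊, a k) - ρ * t| ≤ C * t ^ (1 - δ))
    (n : ℕ) (hn : 1 ≤ n) (hm : Measurable fun t : ℝ => (∑ k ∈ Finset.Icc 1 ⌊t⌋₊, a k) - ρ * t) :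
    Tendsto (fun x : ℝ => (∑ k ∈ Finset.Icc 1 ⌊x⌋₊, a k * Real.log k ^ n / k)
        - ρ * Real.log x ^ (n + 1) / (n + 1)) atTop
      (nhds ((∫ t in Set.Ioi (1 : ℝ), ((∑ k ∈ Finset.Icc 1 ⌊t⌋₊, a k) - ρ * t) *
          (Real.log t ^ n / t ^ 2)) - n * ∫ t in Set.Ioi (1 : ℝ),
          ((∑ k ∈ Finset.Icc 1 ⌊t⌋₊, a k) - ρ * t) * (Real.log t ^ (n - 1) / t ^ 2))) := by
  have i1 := ds_integrable _ hm C δ hδ hb n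
  have i2 := (ds_integrable _ hm C δ hδ hb (n - 1)).const_mul (n : ℝ)
  rw [← MeasureTheory.integral_const_mul, ← MeasureTheory.integral_sub i1 i2]
  have h := (ds_tendsto_zero _ C δ hδ hb n).add
    (MeasureTheory.intervalIntegral_tendsto_integral_Ioi 1 (i1.sub i2) tendsto_id)
  rw [zero_add] at h
  refine h.congr' ?_
  filter_upwards [eventually_ge_atTop 1] with x hx
  rw [ds_abel a ha ρ n hn x hx]
  rfl

theorem ds_zeta (a : ℕ → ℝ) (ha : ∀ k, 0 ≤ a k) (ρ C δ : ℝ) (hδ : 0 < δ)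
    (hb : ∀ t : ℝ, 1 ≤ t → |(∑ k ∈ Finset.Icc 1 ⌊t⌋₊, a k) - ρ * t| ≤ C * t ^ (1 - δ))
    (hm : Measurable fun t : ℝ => (∑ k ∈ Finset.Icc 1 ⌊t⌋₊, a k) - ρ * t) (x : ℝ) (hx : 0 < x) :
    LSeries (fun k => (a k : ℂ)) (1 + x : ℝ) = ((ρ / x + (ρ + (1 + x) *
      ∫ t in Set.Ioi (1 : ℝ), ((∑ k ∈ Finset.Icc 1 ⌊t⌋₊, a k) - ρ * t) * t ^ (-(2 + x)) : ℝ) : ℝ) : ℂ) := by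
  have hO : (fun n : ℕ ↦ ∑ k ∈ Finset.Icc 1 n, a k) =O[atTop] fun n ↦ (n : ℝ) ^ (1 : ℝ) := by
    refine Asymptotics.IsBigO.of_bound (C + |ρ|) ?_
    filter_upwards [eventually_ge_atTop 1] with n hn
    have hn' : (1 : ℝ) ≤ n := by exact_mod_cast hn
    have h := hb n hn'
    rw [Nat.floor_natCast] at h
    have hC : 0 ≤ C := by
      have := hb 1 le_rfl
      rw [Real.one_rpow, mul_one C] at this
      exact (abs_nonneg _).trans this
    have h1 : C * (n : ℝ) ^ (1 - δ) ≤ C * n := by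
      gcongr
      calc (n : ℝ) ^ (1 - δ) ≤ (n : ℝ) ^ (1 : ℝ) :=
            Real.rpow_le_rpow_of_exponent_le hn' (by linarith)
        _ = n := Real.rpow_one _
    rw [Real.rpow_one, Real.norm_eq_abs, Real.norm_eq_abs, Nat.abs_cast]
    calc |∑ k ∈ Finset.Icc 1 n, a k| = |((∑ k ∈ Finset.Icc 1 n, a k) - ρ * n) + ρ * n| := by ring_nf
      _ ≤ |(∑ k ∈ Finset.Icc 1 n, a k) - ρ * n| + |ρ * n| := abs_add_le _ _
      _ ≤ C * n + |ρ| * n := by rw [abs_mul, Nat.abs_cast]; linarith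
      _ = _ := by ring
  rw [LSeries_eq_mul_integral_of_nonneg a zero_le_one (s := ((1 + x : ℝ) : ℂ)) (by simpa using hx) hO ha]
  have e1 : ∫ t in Set.Ioi (1 : ℝ), (∑ k ∈ Finset.Icc 1 ⌊t⌋₊, (a k : ℂ)) *
      (t : ℂ) ^ (-(((1 + x : ℝ) : ℂ) + 1)) = ((∫ t in Set.Ioi (1 : ℝ),
        (∑ k ∈ Finset.Icc 1 ⌊t⌋₊, a k) * t ^ (-(2 + x)) : ℝ) : ℂ) := by
    rw [← integral_complex_ofReal]
    refine MeasureTheory.setIntegral_congr_fun measurableSet_Ioi ?_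
    intro t ht
    have ht0 : (0 : ℝ) ≤ t := by have : 1 < t := ht; linarith
    simp only
    push_cast [Complex.ofReal_cpow ht0]
    ring_nf
  have i1 : MeasureTheory.IntegrableOn (fun t : ℝ => ((∑ k ∈ Finset.Icc 1 ⌊t⌋₊, a k) - ρ * t) *
      t ^ (-(2 + x))) (Set.Ioi 1) := by
    have := ds_integrable _ hm C δ hδ hb 0
    refine MeasureTheory.Integrable.mono this
      ((hm.mul (by fun_prop)).aestronglyMeasurable) ?_
    refine (MeasureTheory.ae_restrict_iff' measurableSet_Ioi).2 (Eventually.of_forall ?_)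
    intro t ht
    have ht : 1 < t := ht
    have ht0 : 0 < t := by linarith
    rw [norm_mul, norm_mul]
    gcongr
    rw [Real.norm_of_nonneg (by positivity), Real.norm_of_nonneg (by positivity), pow_zero,
      one_div, ← Real.rpow_natCast, ← Real.rpow_neg ht0.le]
    exact Real.rpow_le_rpow_of_exponent_le ht.le (by push_cast; linarith)
  have i2 : MeasureTheory.IntegrableOn (fun t : ℝ => ρ * t ^ (-1 - x)) (Set.Ioi 1) :=
    (integrableOn_Ioi_rpow_of_lt (by linarith) one_pos).const_mul _
  have e2 : ∫ t in Set.Ioi (1 : ℝ), (∑ k ∈ Finset.Icc 1 ⌊t⌋₊, a k) * t ^ (-(2 + x)) =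
      (∫ t in Set.Ioi (1 : ℝ), ((∑ k ∈ Finset.Icc 1 ⌊t⌋₊, a k) - ρ * t) * t ^ (-(2 + x)))
        + ρ / x := by
    have : ρ / x = ∫ t in Set.Ioi (1 : ℝ), ρ * t ^ (-1 - x) := by
      rw [MeasureTheory.integral_const_mul, integral_Ioi_rpow_of_lt (by linarith) one_pos]
      have e : -1 - x + 1 = -x := by ring
      rw [e, Real.one_rpow]
      field_simp
    rw [this, ← MeasureTheory.integral_add i1 i2]
    refine MeasureTheory.setIntegral_congr_fun measurableSet_Ioi ?_
    intro t ht
    have ht0 : (0 : ℝ) < t := by have : 1 < t := ht; linarith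
    have : t ^ (-1 - x) = t * t ^ (-(2 + x)) := by
      conv_rhs => rw [← Real.rpow_one t, ← Real.rpow_mul ht0.le, ← Real.rpow_add ht0]
      congr 1; ring
    simp only [this]
    ring
  rw [e1, e2, ← Complex.ofReal_mul]
  congr 1
  field_simp
  ring

theorem ds_main (a : ℕ → ℝ) (ha : ∀ k, 0 ≤ a k) (ha0 : a 0 = 0) (ρ C δ : ℝ) (hδ : 0 < δ)
    (hb : ∀ t : ℝ, 1 ≤ t → |(∑ k ∈ Finset.Icc 1 ⌊t⌋₊, a k) - ρ * t| ≤ C * t ^ (1 - δ))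
    (Z : ℂ → ℂ) (γ : ℕ → ℝ)
    (hZ : ∀ x : ℝ, 0 < x → Z (1 + x : ℝ) = LSeries (fun k => (a k : ℂ)) (1 + x : ℝ))
    (hγ : ∀ s : ℂ, s ≠ 1 →
      HasSum (fun n : ℕ => (γ n : ℂ) * (s - 1) ^ n) (Z s - (ρ : ℂ) / (s - 1)))
    (n : ℕ) (hn : 1 ≤ n) :
    ∃ L : ℝ, Tendsto (fun x : ℝ => (∑ k ∈ Finset.Icc 1 ⌊x⌋₊, a k * Real.log k ^ n / k)
        - ρ * Real.log x ^ (n + 1) / (n + 1)) atTop (nhds L)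
      ∧ γ n = (-1 : ℝ) ^ n / (n.factorial : ℝ) * L := by
  have hm : Measurable fun t : ℝ => (∑ k ∈ Finset.Icc 1 ⌊t⌋₊, a k) - ρ * t := by
    have : Measurable fun t : ℝ => ∑ k ∈ Finset.Icc 1 ⌊t⌋₊, a k :=
      (measurable_from_top (f := fun n : ℕ => ∑ k ∈ Finset.Icc 1 n, a k)).comp Nat.measurable_floor
    fun_prop
  refine ⟨_, ds_limit a ha0 ρ C δ hδ hb n hn hm, ?_⟩
  set I : ℕ → ℝ := fun j => ∫ t in Set.Ioi (1 : ℝ), ((∑ k ∈ Finset.Icc 1 ⌊t⌋₊, a k) - ρ * t) *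
          (Real.log t ^ j / t ^ 2) with hI
  set G : ℝ → ℝ := fun x => ∫ t in Set.Ioi (1 : ℝ), ((∑ k ∈ Finset.Icc 1 ⌊t⌋₊, a k) - ρ * t) *
    t ^ (-(2 + x)) with hG
  set g : ℕ → ℝ := fun j => (-1) ^ j / (j.factorial : ℝ) * I j with hg
  have hGs : ∀ x, |x| < δ → HasSum (fun j => g j * x ^ j) (G x) := fun x hx =>
    ds_expand _ hm C δ hδ hb x hx
  let F : ℝ → ℝ := fun x => if x = 0 then γ 0 else (Z (1 + x : ℝ) - (ρ : ℂ) / x).re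
  have hF : ∀ x, |x| < δ → HasSum (fun n => γ n * x ^ n) (F x) := by
    intro x _
    by_cases h0 : x = 0
    · subst h0
      have : F 0 = γ 0 * 0 ^ 0 := by simp [F]
      rw [this]
      exact hasSum_single 0 (fun n hn => by simp [hn])
    · have h := hγ ((1 + x : ℝ) : ℂ) (by
        intro h
        apply h0
        have : (1 + x : ℝ) = 1 := by exact_mod_cast h
        linarith)
      have h2 := Complex.hasSum_re h
      have e : ((1 + x : ℝ) : ℂ) - 1 = x := by push_cast; ring
      simp only [F, if_neg h0]
      rw [e] at h2
      refine ds_hasSum_congr h2 (fun n => ?_) rfl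
      rw [← Complex.ofReal_pow, ← Complex.ofReal_mul, Complex.ofReal_re]
  let b : ℕ → ℝ := fun n => g n + (if n = 0 then ρ else g (n - 1))
  have hB : ∀ x, |x| < δ → HasSum (fun n => b n * x ^ n) (ρ + (1 + x) * G x) := by
    intro x hx
    have h1 := hGs x hx
    have h2 : HasSum (fun n => (if n = 0 then ρ else g (n - 1)) * x ^ n) (ρ + x * G x) := by
      rw [← hasSum_nat_add_iff' 1]
      simp only [Finset.sum_range_one, if_true, pow_zero, mul_one, add_sub_cancel_left]
      refine ds_hasSum_congr (h1.mul_left x) (fun j => ?_) rfl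
      simp only [Nat.succ_ne_zero, if_false, Nat.add_sub_cancel]
      ring
    refine ds_hasSum_congr (h1.add h2) (fun j => ?_) ?_
    · simp only [b]; ring
    · ring
  have heq := ds_coeff_eq γ b F (fun x => ρ + (1 + x) * G x) δ hδ hF hB (by
    intro x hx _
    simp only [F, if_neg hx.ne']
    rw [hZ x hx, ds_zeta a ha ρ C δ hδ hb hm x hx, ← Complex.ofReal_div, ← Complex.ofReal_sub,
      Complex.ofReal_re]
    simp only [hG]
    ring)
  rw [heq]
  change b n = (-1 : ℝ) ^ n / (n.factorial : ℝ) * (I n - n * I (n - 1))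
  clear_value I
  obtain ⟨m, rfl⟩ : ∃ m, n = m + 1 := ⟨n - 1, by omega⟩
  simp only [b, hg, Nat.add_sub_cancel, Nat.succ_ne_zero, if_false, Nat.factorial_succ]
  push_cast
  field_simp
  ring

theorem ds_count (K : Type*) [Field K] [NumberField K] (t : ℝ) (ht : 1 ≤ t) :
    Nat.card {I : Ideal (𝓞 K) // I ≠ ⊥ ∧ (Ideal.absNorm I : ℝ) ≤ t} =
      ∑ k ∈ Finset.Icc 1 ⌊t⌋₊, Nat.card {I : Ideal (𝓞 K) // Ideal.absNorm I = k} := by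
  rw [← Finset.card_preimage_eq_sum_card_image_eq (fun k _ ↦ Ideal.finite_setOfPred_absNorm_eq k)]
  refine Nat.card_congr (Equiv.subtypeEquivRight fun I => ?_)
  simp only [Set.mem_preimage, Finset.coe_Icc, Set.mem_Icc, Nat.one_le_iff_ne_zero, ne_eq,
    Ideal.absNorm_eq_zero_iff, Nat.le_floor_iff (show 0 ≤ t by linarith)]

theorem ds_lseries (K : Type*) [Field K] [NumberField K] (s : ℂ) (z : ℂ)
    (h : HasSum (fun I : {I : Ideal (𝓞 K) // I ≠ ⊥} => (Ideal.absNorm I.1 : ℂ) ^ (-s)) z) :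
    z = LSeries (fun k => ((if k = 0 then 0 else
      (Nat.card {I : Ideal (𝓞 K) // Ideal.absNorm I = k} : ℝ) : ℝ) : ℂ)) s := by
  have h2 := (h.tsum_fiberwise (fun I => Ideal.absNorm I.1)).tsum_eq
  rw [← h2, LSeries]
  refine tsum_congr fun k => ?_
  by_cases hk : k = 0
  · subst hk
    have : IsEmpty ((fun I : {I : Ideal (𝓞 K) // I ≠ ⊥} => Ideal.absNorm I.1) ⁻¹' {0}) :=
      ⟨fun ⟨I, hI⟩ => I.2 (Ideal.absNorm_eq_zero_iff.1 hI)⟩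
    simp
  · rw [LSeries.term_of_ne_zero hk, if_neg hk]
    have : ∀ b : ((fun I : {I : Ideal (𝓞 K) // I ≠ ⊥} => Ideal.absNorm I.1) ⁻¹' {k}),
        (Ideal.absNorm b.1.1 : ℂ) ^ (-s) = (k : ℂ) ^ (-s) := fun b => by
      have : Ideal.absNorm b.1.1 = k := b.2
      rw [this]
    rw [tsum_congr this, tsum_const, nsmul_eq_mul, Complex.cpow_neg, div_eq_mul_inv]
    have hc : Nat.card ((fun I : {I : Ideal (𝓞 K) // I ≠ ⊥} => Ideal.absNorm I.1) ⁻¹' {k}) =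
        Nat.card {I : Ideal (𝓞 K) // Ideal.absNorm I = k} := by
      refine Nat.card_congr ⟨fun b => ⟨b.1.1, b.2⟩, fun b => ⟨⟨b.1, ?_⟩, b.2⟩,
        fun _ => rfl, fun _ => rfl⟩
      intro h0
      apply hk
      rw [← b.2, h0]
      simp
    rw [hc]
    push_cast
    rfl

/-- For a number field `K`, the Stieltjes constants `γ_n(K)` of the Dedekind zeta function
satisfy, for `n ≥ 1`,
`γ_n(K) = ((−1)^n/n!) lim_{x→∞} (∑_{N𝔞≤x} (log N𝔞)^n/N𝔞 − ρ (log x)^{n+1}/(n+1))`. -/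
theorem dedekind_stieltjes_formula (K : Type*) [Field K] [NumberField K]
    (ρ : ℝ) (Z : ℂ → ℂ) (γ : ℕ → ℝ)
    (hZ : ∀ s : ℂ, 1 < s.re →
      HasSum (fun I : {I : Ideal (𝓞 K) // I ≠ ⊥} =>
        (Ideal.absNorm I.1 : ℂ) ^ (-s)) (Z s))
    (hγ : ∀ s : ℂ, s ≠ 1 →
      HasSum (fun n : ℕ => (γ n : ℂ) * (s - 1) ^ n) (Z s - (ρ : ℂ) / (s - 1)))
    (hcount : ∃ C : ℝ, ∀ t : ℝ, 1 ≤ t →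
      |(Nat.card {I : Ideal (𝓞 K) // I ≠ ⊥ ∧ (Ideal.absNorm I : ℝ) ≤ t} : ℝ) - ρ * t|
        ≤ C * t ^ ((1 : ℝ) - 1 / (Module.finrank ℚ K : ℝ)))
    (n : ℕ) (hn : 1 ≤ n) :
    ∃ L : ℝ, Tendsto
      (fun x : ℝ =>
        (∑ k ∈ Finset.Icc 1 ⌊x⌋₊,
          (Nat.card {I : Ideal (𝓞 K) // Ideal.absNorm I = k} : ℝ) * (Real.log k) ^ n / k)
        - ρ * (Real.log x) ^ (n + 1) / (n + 1)) atTop (nhds L)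
      ∧ γ n = (-1 : ℝ) ^ n / (n.factorial : ℝ) * L := by
  obtain ⟨C, hC⟩ := hcount
  have hfr : 0 < Module.finrank ℚ K := Module.finrank_pos
  have hsum : ∀ (f g : ℕ → ℝ) (m : ℕ), (∀ k, k ≠ 0 → f k = g k) →
      ∑ k ∈ Finset.Icc 1 m, f k = ∑ k ∈ Finset.Icc 1 m, g k := by
    intro f g m h
    refine Finset.sum_congr rfl fun k hk => h k ?_
    have := (Finset.mem_Icc.1 hk).1
    omega
  have key := ds_main (fun k => if k = 0 then 0 else
      (Nat.card {I : Ideal (𝓞 K) // Ideal.absNorm I = k} : ℝ))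
    (fun k => by split_ifs <;> positivity) (by simp) ρ C
    (1 / (Module.finrank ℚ K : ℝ)) (by positivity)
    (fun t ht => by
      have h := hC t ht
      rw [ds_count K t ht] at h
      push_cast at h
      rw [hsum _ (fun k => (Nat.card {I : Ideal (𝓞 K) // Ideal.absNorm I = k} : ℝ)) _
        (fun k hk => if_neg hk)]
      exact h)
    Z γ (fun x hx => ds_lseries K _ _ (hZ _ (by simpa using hx))) hγ n hn
  obtain ⟨L, hL, hL'⟩ := key
  refine ⟨L, hL.congr fun x => ?_, hL'⟩
  rw [hsum _ _ _ (fun k hk => by rw [if_neg hk])]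
end

section
/- Let K be a number field and γ_n(K) the Stieltjes constants of the Dedekind zeta function ζ_K at s = 1. Then each of the inequalities γ_{2n}(K) > 0, γ_{2n}(K) < 0, γ_{2n−1}(K) > 0, γ_{2n−1}(K) < 0 holds for infinitely many positive integers n. -/
open Filter NumberField

section PoissonSection
open MeasureTheory

theorem aux_finite_int {ι : Type*} [Fintype ι] (R : ℝ) :
    {m : ι → ℤ | ∀ i, |(m i : ℝ)| ≤ R}.Finite := by
  classical
  refine (Set.finite_Icc (fun _ : ι => -⌈R⌉) (fun _ => ⌈R⌉)).subset ?_
  intro m hm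
  constructor
  · intro i
    have h1 := (abs_le.1 (hm i)).1
    have h2 := Int.le_ceil R
    have : (-⌈R⌉ : ℝ) ≤ m i := by linarith
    exact_mod_cast this
  · intro i
    have h1 := (abs_le.1 (hm i)).2
    have h2 := Int.le_ceil R
    have : (m i : ℝ) ≤ ⌈R⌉ := by linarith
    exact_mod_cast this

/-- integer vector as real vector -/
def auxCast {ι : Type*} (m : ι → ℤ) : ι → ℝ := fun i => (m i : ℝ)

theorem aux_locFin {ι : Type*} [Fintype ι] (f : (ι → ℝ) → ℂ) (hs : HasCompactSupport f) :
    LocallyFinite (fun m : ι → ℤ => Function.support (fun y => f (y + auxCast m))) := by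
  obtain ⟨R, hR⟩ := hs.isCompact.isBounded.exists_norm_le
  intro y0
  refine ⟨Metric.ball y0 1, Metric.ball_mem_nhds _ one_pos, ?_⟩
  refine (aux_finite_int (ι := ι) (R + ‖y0‖ + 1)).subset ?_
  rintro m ⟨y, hy1, hy2⟩ i
  have h1 := hR _ (subset_tsupport _ hy1)
  have h2 : ‖y - y0‖ < 1 := by simpa [dist_eq_norm] using hy2
  have h3 : ‖(auxCast m)‖ ≤ R + ‖y0‖ + 1 := by
    have : auxCast m = (y + auxCast m) - (y - y0) - y0 := by abel
    rw [this]
    refine (norm_sub_le _ _).trans ?_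
    have := norm_sub_le (y + auxCast m) (y - y0)
    linarith
  have h4 := norm_le_pi_norm (auxCast m) i
  rw [← Real.norm_eq_abs]
  exact h4.trans h3

/-- The periodization. -/
noncomputable def auxPer {ι : Type*} (f : (ι → ℝ) → ℂ) (y : ι → ℝ) : ℂ :=
  ∑' m : ι → ℤ, f (y + auxCast m)

theorem auxPer_cont {ι : Type*} [Fintype ι] (f : (ι → ℝ) → ℂ) (hs : HasCompactSupport f)
    (hc : Continuous f) : Continuous (auxPer f) := by
  have h := aux_locFin f hs
  have : auxPer f = fun y => ∑ᶠ m : ι → ℤ, f (y + auxCast m) := by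
    ext y
    refine tsum_eq_finsum ?_
    refine (h.point_finite y).subset ?_
    intro m hm; exact hm
  rw [this]
  exact continuous_finsum (fun m => by fun_prop) h

theorem aux_poisson {ι : Type*} [Fintype ι] (f : (ι → ℝ) → ℂ) (hs : HasCompactSupport f)
    (hc : Continuous f)
    (hsum : Summable fun n : ι → ℤ =>
      ∫ y : ι → ℝ, Complex.exp (-2 * Real.pi * Complex.I * (∑ i, (n i : ℝ) * y i : ℝ)) * f y) :
    HasSum (fun n : ι → ℤ =>
      ∫ y : ι → ℝ, Complex.exp (-2 * Real.pi * Complex.I * (∑ i, (n i : ℝ) * y i : ℝ)) * f y)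
      (∑' m : ι → ℤ, f (auxCast m)) := by
  classical
  let π : (ι → ℝ) → UnitAddTorus ι := fun y i => (y i : UnitAddCircle)
  have hπ : IsOpenQuotientMap π :=
    IsOpenQuotientMap.piMap (fun _ : ι => (QuotientAddGroup.isOpenQuotientMap_mk :
      IsOpenQuotientMap (QuotientAddGroup.mk : ℝ → UnitAddCircle)))
  have hper : ∀ (y : ι → ℝ) (m : ι → ℤ), auxPer f (y + auxCast m) = auxPer f y := by
    intro y m
    unfold auxPer
    rw [← (Equiv.addLeft m).tsum_eq (fun k => f (y + auxCast k))]
    refine tsum_congr fun k => ?_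
    congr 1
    ext i; simp [auxCast]; ring
  let G0 : UnitAddTorus ι → ℂ := fun θ => auxPer f (Function.surjInv hπ.surjective θ)
  have hG0 : ∀ y, G0 (π y) = auxPer f y := by
    intro y
    have h1 : π (Function.surjInv hπ.surjective (π y)) = π y := Function.surjInv_eq _ _
    have h2 : ∀ i, ∃ k : ℤ, Function.surjInv hπ.surjective (π y) i = y i + k := by
      intro i
      have h3 := congrFun h1 i
      have h4 : ((Function.surjInv hπ.surjective (π y) i - y i : ℝ) : UnitAddCircle) = 0 := by
        rw [AddCircle.coe_sub]; exact sub_eq_zero.2 h3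
      obtain ⟨k, hk⟩ := (AddCircle.coe_eq_zero_iff (1 : ℝ)).1 h4
      exact ⟨k, by simp at hk; linarith⟩
    choose k hk using h2
    have : Function.surjInv hπ.surjective (π y) = y + auxCast k := funext hk
    simp only [G0, this, hper]
  let G : C(UnitAddTorus ι, ℂ) := ⟨G0, by
    rw [hπ.isQuotientMap.continuous_iff]
    have : G0 ∘ π = auxPer f := funext hG0
    rw [this]
    exact auxPer_cont f hs hc⟩
  have hexp : ∀ (n : ι → ℤ) (y : ι → ℝ), UnitAddTorus.mFourier (-n) (π y) =
      Complex.exp (-2 * Real.pi * Complex.I * (∑ i, (n i : ℝ) * y i : ℝ)) := by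
    intro n y
    simp only [UnitAddTorus.mFourier, ContinuousMap.coe_mk, π, fourier_coe_apply]
    rw [← Complex.exp_sum]
    congr 1
    push_cast
    rw [Finset.mul_sum]
    refine Finset.sum_congr rfl fun i _ => ?_
    simp; ring
  have hexpper : ∀ (n m : ι → ℤ) (y : ι → ℝ),
      UnitAddTorus.mFourier (-n) (π (y + auxCast m)) = UnitAddTorus.mFourier (-n) (π y) := by
    intro n m y
    congr 1
    ext i
    simp [π, auxCast]
  have hcoef : ∀ n, UnitAddTorus.mFourierCoeff G n =
      ∫ y : ι → ℝ, Complex.exp (-2 * Real.pi * Complex.I * (∑ i, (n i : ℝ) * y i : ℝ)) * f y := by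
    intro n
    rw [UnitAddTorus.mFourierCoeff_eq_integral G n 0]
    let φ : (ι → ℝ) → ℂ := fun y => UnitAddTorus.mFourier (-n) (π y) * f y
    have hφc : Continuous φ := ((UnitAddTorus.mFourier (-n)).continuous.comp hπ.continuous).mul hc
    have hφs : HasCompactSupport φ := hs.mul_left
    have hφi : Integrable φ := hφc.integrable_of_hasCompactSupport hφs
    let B : (ι → ℤ) → Set (ι → ℝ) := fun m => {x | ∀ i, x i ∈ Set.Ioc (m i : ℝ) (m i + 1)}
    have hBm : ∀ m, MeasurableSet (B m) := fun m =>
      MeasurableSet.univ_pi' fun i => measurableSet_Ioc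
    have hmem : ∀ (x : ℝ) (m : ℤ), x ∈ Set.Ioc (m : ℝ) (m + 1) ↔ ⌈x⌉ = m + 1 := by
      intro x m
      rw [Int.ceil_eq_iff]; simp
    have hBd : Pairwise (Function.onFun Disjoint B) := by
      intro m m' hne
      rw [Function.onFun, Set.disjoint_left]
      intro x h1 h2
      apply hne
      ext i
      have e1 := (hmem _ _).1 (h1 i)
      have e2 := (hmem _ _).1 (h2 i)
      omega
    have hBu : (⋃ m, B m) = Set.univ := by
      rw [Set.eq_univ_iff_forall]
      intro x
      refine Set.mem_iUnion.2 ⟨fun i => ⌈x i⌉ - 1, fun i => (hmem _ _).2 (by simp)⟩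
    have hB0 : {x : ι → ℝ | ∀ i, x i ∈ Set.Ioc ((0 : ι → ℝ) i) ((0 : ι → ℝ) i + 1)} = B 0 := by
      simp [B]
    have h1 := hasSum_integral_iUnion (f := φ) (μ := volume) hBm hBd hφi.integrableOn
    rw [hBu, setIntegral_univ] at h1
    have h2 : ∀ m, ∫ x in B m, φ x = ∫ x in B 0, φ (x + auxCast m) := by
      intro m
      have hp : MeasurePreserving (fun x : ι → ℝ => x + auxCast m) volume volume :=
        measurePreserving_add_right _ _
      rw [← hp.setIntegral_preimage_emb (MeasurableEquiv.addRight (auxCast m)).measurableEmbedding]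
      congr 1
      congr 1
      ext x
      simp only [B, Set.mem_preimage, Set.mem_ofPred_eq, Pi.add_apply, auxCast, Set.mem_Ioc]
      refine forall_congr' fun i => ?_
      constructor
      · rintro ⟨a, b⟩; constructor <;> simp <;> linarith
      · rintro ⟨a, b⟩; simp at a b; constructor <;> linarith
    obtain ⟨R, hR⟩ := hs.isCompact.isBounded.exists_norm_le
    have hfin := aux_finite_int (ι := ι) (R + 1)
    have hvan : ∀ x ∈ B 0, ∀ m ∉ hfin.toFinset, f (x + auxCast m) = 0 := by
      intro x hx m hm
      by_contra hne
      apply hm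
      rw [Set.Finite.mem_toFinset]
      intro i
      have h1 := (norm_le_pi_norm _ i).trans (hR _ (subset_tsupport _ hne))
      have h2 := hx i
      simp [auxCast] at h1 h2
      rw [abs_le] at h1 ⊢
      constructor <;> linarith [h1.1, h1.2, h2.1, h2.2]
    have h3 : ∫ x in B 0, UnitAddTorus.mFourier (-n) (π x) • G (π x) =
        ∑ m ∈ hfin.toFinset, ∫ x in B 0, φ (x + auxCast m) := by
      rw [← integral_finsetSum]
      · refine setIntegral_congr_fun (hBm 0) fun x hx => ?_
        change _ • G0 (π x) = _
        rw [hG0, auxPer, tsum_eq_sum (hvan x hx), smul_eq_mul, Finset.mul_sum]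
        refine Finset.sum_congr rfl fun m _ => ?_
        simp only [φ]
        rw [hexpper]
      · intro m _
        exact (hφi.comp_add_right (auxCast m)).integrableOn
    have h4 : HasSum (fun m => ∫ x in B m, φ x) (∑ m ∈ hfin.toFinset, ∫ x in B m, φ x) := by
      refine hasSum_sum_of_ne_finset_zero fun m hm => ?_
      rw [h2]
      refine setIntegral_eq_zero_of_forall_eq_zero fun x hx => ?_
      simp only [φ]
      rw [hvan x hx m hm, mul_zero]
    rw [hB0]
    refine h3.trans ?_
    simp_rw [← h2]
    rw [h4.unique h1]
    refine integral_congr_ae (ae_of_all _ fun y => ?_)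
    simp only [φ, hexp]
  have hS : Summable (UnitAddTorus.mFourierCoeff G) := by
    convert hsum using 1
    exact funext hcoef
  have hfin := UnitAddTorus.hasSum_mFourier_series_apply_of_summable hS (π 0)
  have e0 : G (π 0) = ∑' m : ι → ℤ, f (auxCast m) := by
    change G0 (π 0) = _
    rw [hG0]; simp [auxPer]
  rw [e0] at hfin
  convert hfin using 1
  ext n
  rw [hcoef n]
  have : UnitAddTorus.mFourier n (π 0) = 1 := by
    simp [UnitAddTorus.mFourier, π]
  rw [this, smul_eq_mul, mul_one]

end PoissonSection

section LatticeBound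
open MeasureTheory FourierTransform
open scoped SchwartzMap

theorem aux_integral_linear {E F : Type*} [NormedAddCommGroup E] [NormedSpace ℝ E]
    [MeasurableSpace E] [BorelSpace E] [FiniteDimensional ℝ E] (μ : Measure E) [μ.IsAddHaarMeasure]
    [NormedAddCommGroup F] [NormedSpace ℝ F]
    (T : E ≃L[ℝ] E) (φ : E → F) :
    ∫ x, φ (T x) ∂μ = |LinearMap.det (T : E →ₗ[ℝ] E)|⁻¹ • ∫ x, φ x ∂μ := by
  have hdet : LinearMap.det (T : E →ₗ[ℝ] E) ≠ 0 := (LinearEquiv.isUnit_det' T.toLinearEquiv).ne_zero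
  have h := Measure.map_linearMap_addHaar_eq_smul_addHaar μ hdet
  have h2 : ∫ x, φ x ∂(Measure.map (T : E → E) μ) = ∫ x, φ (T x) ∂μ :=
    T.toHomeomorph.measurableEmbedding.integral_map φ
  rw [← h2]
  have h3 : Measure.map (T : E → E) μ = Measure.map (T : E →ₗ[ℝ] E) μ := rfl
  rw [h3, h, integral_smul_measure, abs_inv]
  congr 1
  rw [ENNReal.toReal_ofReal (by positivity)]

theorem aux_summable_norm {ι : Type*} [Fintype ι] (M : ℕ) (hM : Fintype.card ι < M) :
    Summable fun n : ι → ℤ => (‖(WithLp.toLp 2 (auxCast n) : EuclideanSpace ℝ ι)‖ ^ M)⁻¹ := by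
  classical
  let b := (EuclideanSpace.basisFun ι ℝ).toBasis
  let L := Submodule.span ℤ (Set.range b)
  have hr : Module.finrank ℤ L = Fintype.card ι := by
    rw [ZLattice.rank ℝ L, finrank_euclideanSpace]
  have h := ZLattice.summable_norm_pow_inv L M (by rw [hr]; exact hM)
  have hmem : ∀ n : ι → ℤ, (WithLp.toLp 2 (auxCast n) : EuclideanSpace ℝ ι) ∈ L := by
    intro n
    have : (WithLp.toLp 2 (auxCast n) : EuclideanSpace ℝ ι) = ∑ i, n i • b i := by
      ext j
      simp [b, auxCast, Finset.sum_apply, Pi.single_apply]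
    rw [this]
    exact Submodule.sum_mem _ fun i _ => Submodule.smul_mem _ _ (Submodule.subset_span ⟨i, rfl⟩)
  have hinj : Function.Injective (fun n : ι → ℤ => (⟨_, hmem n⟩ : L)) := by
    intro n m hnm
    have h1 := congrArg Subtype.val hnm
    ext i
    have h2 := congrArg (fun v : EuclideanSpace ℝ ι => v i) h1
    simpa [auxCast] using h2
  have h3 := h.comp_injective hinj
  refine h3.congr fun n => ?_
  simp

theorem aux_lattice_bound {ι : Type*} [Fintype ι] (g : EuclideanSpace ℝ ι → ℂ)
    (hg : ContDiff ℝ (⊤ : ℕ∞) g) (hs : HasCompactSupport g) (h0 : ∫ x, g x = 0)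
    (M : ℕ) (hM : Fintype.card ι < M) :
    ∃ C : ℝ, 0 ≤ C ∧ ∀ T : EuclideanSpace ℝ ι ≃L[ℝ] EuclideanSpace ℝ ι,
      ‖∑' m : ι → ℤ, g (T (WithLp.toLp 2 (auxCast m)))‖ ≤
        C * |LinearMap.det (T : EuclideanSpace ℝ ι →ₗ[ℝ] EuclideanSpace ℝ ι)|⁻¹ *
          ‖(T : EuclideanSpace ℝ ι →L[ℝ] EuclideanSpace ℝ ι)‖ ^ M := by
  classical
  let V := EuclideanSpace ℝ ι
  let S : 𝓢(V, ℂ) := hs.toSchwartzMap hg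
  obtain ⟨C0, hC0, hdec⟩ := (𝓕 S).decay M 0
  have hdec' : ∀ ξ : V, ‖ξ‖ ^ M * ‖𝓕 g ξ‖ ≤ C0 := by
    intro ξ
    have := hdec ξ
    rw [norm_iteratedFDeriv_zero] at this
    exact this
  have hsm := aux_summable_norm (ι := ι) M hM
  refine ⟨C0 * ∑' n : ι → ℤ, (‖(WithLp.toLp 2 (auxCast n) : V)‖ ^ M)⁻¹,
    mul_nonneg hC0.le (tsum_nonneg fun n => by positivity), fun T => ?_⟩
  set d := |LinearMap.det (T : V →ₗ[ℝ] V)|⁻¹ with hd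
  have hdnn : 0 ≤ d := by positivity
  let f : (ι → ℝ) → ℂ := fun y => g (T (WithLp.toLp 2 y))
  have hfc : Continuous f := hg.continuous.comp (T.continuous.comp (PiLp.continuous_toLp 2 _))
  have hfs : HasCompactSupport f :=
    hs.comp_homeomorph ((PiLp.homeomorph 2 (fun _ : ι => ℝ)).symm.trans T.toHomeomorph)
  let A : V →L[ℝ] V := ContinuousLinearMap.adjoint (T.symm : V →L[ℝ] V)
  have hIntEq : ∀ n : ι → ℤ,
      ∫ y : ι → ℝ, Complex.exp (-2 * Real.pi * Complex.I * (∑ i, (n i : ℝ) * y i : ℝ)) * f y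
        = d • 𝓕 g (A (WithLp.toLp 2 (auxCast n))) := by
    intro n
    let ψ : V → ℂ := fun v => Complex.exp (-2 * Real.pi * Complex.I *
      (inner ℝ (T.symm v) (WithLp.toLp 2 (auxCast n) : V) : ℝ)) * g v
    have e1 : ∫ y : ι → ℝ,
        Complex.exp (-2 * Real.pi * Complex.I * (∑ i, (n i : ℝ) * y i : ℝ)) * f y =
        ∫ v : V, ψ (T v) := by
      rw [← (PiLp.volume_preserving_toLp ι).integral_comp
        (MeasurableEquiv.toLp 2 (ι → ℝ)).measurableEmbedding]
      refine integral_congr_ae (ae_of_all _ fun y => ?_)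
      simp only [ψ, f, ContinuousLinearEquiv.symm_apply_apply]
      congr 4
    rw [e1, aux_integral_linear volume T ψ]
    congr 1
    rw [Real.fourier_eq']
    refine integral_congr_ae (ae_of_all _ fun v => ?_)
    simp only [ψ, A, smul_eq_mul]
    rw [ContinuousLinearMap.adjoint_inner_right]
    congr 2
    push_cast
    simp
    ring
  have hbd : ∀ n : ι → ℤ, ‖d • 𝓕 g (A (WithLp.toLp 2 (auxCast n)))‖ ≤
      C0 * d * ‖(T : V →L[ℝ] V)‖ ^ M * (‖(WithLp.toLp 2 (auxCast n) : V)‖ ^ M)⁻¹ := by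
    intro n
    by_cases hn : n = 0
    · have : 𝓕 g (A (WithLp.toLp 2 (auxCast n))) = 0 := by
        have hz : (WithLp.toLp 2 (auxCast n) : V) = 0 := by
          ext i; simp [hn, auxCast]
        rw [hz, map_zero, Real.fourier_eq']
        simpa using h0
      rw [this, smul_zero, norm_zero]
      positivity
    · have hpos : 0 < ‖(WithLp.toLp 2 (auxCast n) : V)‖ := by
        rw [norm_pos_iff]
        intro h
        apply hn
        ext i
        have := congrArg (fun v : V => v i) h
        simpa [auxCast] using this
      set k : V := WithLp.toLp 2 (auxCast n)
      have hk : ContinuousLinearMap.adjoint (T : V →L[ℝ] V) (A k) = k := by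
        have : (ContinuousLinearMap.adjoint (T : V →L[ℝ] V)).comp A = ContinuousLinearMap.id ℝ V := by
          rw [← ContinuousLinearMap.adjoint_comp]
          have : (T.symm : V →L[ℝ] V).comp (T : V →L[ℝ] V) = ContinuousLinearMap.id ℝ V := by
            exact ContinuousLinearMap.ext fun x => T.symm_apply_apply x
          rw [this, ContinuousLinearMap.adjoint_id]
        exact congrArg (fun L : V →L[ℝ] V => L k) this
      have hle : ‖k‖ ≤ ‖(T : V →L[ℝ] V)‖ * ‖A k‖ := by
        calc ‖k‖ = ‖ContinuousLinearMap.adjoint (T : V →L[ℝ] V) (A k)‖ := by rw [hk]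
          _ ≤ _ := by
            refine (ContinuousLinearMap.le_opNorm _ _).trans ?_
            rw [LinearIsometryEquiv.norm_map]
      rw [norm_smul, Real.norm_of_nonneg hdnn]
      rw [← div_eq_mul_inv, le_div_iff₀ (by positivity)]
      have h1 : ‖k‖ ^ M ≤ ‖(T : V →L[ℝ] V)‖ ^ M * ‖A k‖ ^ M := by
        rw [← mul_pow]; gcongr
      calc d * ‖𝓕 g (A k)‖ * ‖k‖ ^ M ≤ d * ‖𝓕 g (A k)‖ * (‖(T : V →L[ℝ] V)‖ ^ M * ‖A k‖ ^ M) := by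
            gcongr
        _ = d * ‖(T : V →L[ℝ] V)‖ ^ M * (‖A k‖ ^ M * ‖𝓕 g (A k)‖) := by ring
        _ ≤ d * ‖(T : V →L[ℝ] V)‖ ^ M * C0 := by gcongr; exact hdec' _
        _ = _ := by ring
  have hsb := hsm.mul_left (C0 * d * ‖(T : V →L[ℝ] V)‖ ^ M)
  have hS : Summable fun n : ι → ℤ => d • 𝓕 g (A (WithLp.toLp 2 (auxCast n))) :=
    Summable.of_norm_bounded hsb hbd
  have hP := aux_poisson f hfs hfc (by simp_rw [hIntEq]; exact hS)
  rw [← hP.tsum_eq]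
  simp_rw [hIntEq]
  refine (tsum_of_norm_bounded hsb.hasSum hbd).trans (le_of_eq ?_)
  rw [tsum_mul_left]; ring

end LatticeBound

section MulDet
open MeasureTheory mixedEmbedding NumberField.InfinitePlace
open scoped Classical

variable {K : Type*} [Field K] [NumberField K]

theorem auxN_fst {a : mixedSpace K} (ha : mixedEmbedding.norm a ≠ 0)
    (w : {w : InfinitePlace K // IsReal w}) : a.1 w ≠ 0 := by
  have := mixedEmbedding.norm_ne_zero_iff.mp ha w.1
  rw [normAtPlace_apply_of_isReal w.2] at this
  simpa using this

theorem auxN_snd {a : mixedSpace K} (ha : mixedEmbedding.norm a ≠ 0)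
    (w : {w : InfinitePlace K // IsComplex w}) : a.2 w ≠ 0 := by
  have := mixedEmbedding.norm_ne_zero_iff.mp ha w.1
  rw [normAtPlace_apply_of_isComplex w.2] at this
  simpa using this

/-- Multiplication by an element of nonzero norm. -/
noncomputable def auxMul (a : mixedSpace K) (ha : mixedEmbedding.norm a ≠ 0) :
    mixedSpace K ≃L[ℝ] mixedSpace K :=
  (LinearEquiv.ofLinearMap (LinearMap.mulLeft ℝ a) (LinearMap.mulLeft ℝ (a.1⁻¹, a.2⁻¹))
    (by
      refine LinearMap.ext fun x => Prod.ext ?_ ?_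
      · ext w
        have := auxN_fst ha w
        simp only [LinearMap.comp_apply, LinearMap.mulLeft_apply, LinearMap.id_apply,
          Prod.fst_mul, Pi.mul_apply, Pi.inv_apply]
        field_simp
      · ext w
        have := auxN_snd ha w
        simp only [LinearMap.comp_apply, LinearMap.mulLeft_apply, LinearMap.id_apply,
          Prod.snd_mul, Pi.mul_apply, Pi.inv_apply]
        field_simp)
    (by
      refine LinearMap.ext fun x => Prod.ext ?_ ?_
      · ext w
        have := auxN_fst ha w
        simp only [LinearMap.comp_apply, LinearMap.mulLeft_apply, LinearMap.id_apply,
          Prod.fst_mul, Pi.mul_apply, Pi.inv_apply]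
        field_simp
      · ext w
        have := auxN_snd ha w
        simp only [LinearMap.comp_apply, LinearMap.mulLeft_apply, LinearMap.id_apply,
          Prod.snd_mul, Pi.mul_apply, Pi.inv_apply]
        field_simp)).toContinuousLinearEquiv

@[simp] theorem auxMul_apply (a : mixedSpace K) (ha : mixedEmbedding.norm a ≠ 0)
    (x : mixedSpace K) : auxMul a ha x = a * x := rfl

theorem aux_norm_split (a : mixedSpace K) : mixedEmbedding.norm a =
    (∏ w : {w : InfinitePlace K // IsReal w}, ‖a.1 w‖) *
      ∏ w : {w : InfinitePlace K // IsComplex w}, ‖a.2 w‖ ^ 2 := by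
  rw [mixedEmbedding.norm_apply, ← Fintype.prod_subtype_mul_prod_subtype
    (fun w : InfinitePlace K => IsReal w)]
  congr 1
  · refine Finset.prod_congr rfl fun w _ => ?_
    rw [normAtPlace_apply_of_isReal w.2, mult_isReal w, pow_one]
  · refine Fintype.prod_equiv (Equiv.subtypeEquivRight fun w => not_isReal_iff_isComplex) _ _ ?_
    intro w
    have hw := not_isReal_iff_isComplex.mp w.2
    rw [normAtPlace_apply_of_isComplex hw, mult_isComplex ⟨w.1, hw⟩]
    rfl

theorem auxMul_det (a : mixedSpace K) (ha : mixedEmbedding.norm a ≠ 0) :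
    |LinearMap.det (auxMul a ha : mixedSpace K →ₗ[ℝ] mixedSpace K)| = mixedEmbedding.norm a := by
  have h : (auxMul a ha : mixedSpace K →ₗ[ℝ] mixedSpace K) =
      LinearMap.prodMap
        (LinearMap.pi fun w => (LinearMap.mulLeft ℝ (a.1 w)).comp (LinearMap.proj w))
        (LinearMap.pi fun w => (LinearMap.mulLeft ℝ (a.2 w)).comp (LinearMap.proj w)) := by
    refine LinearMap.ext fun x => ?_
    rfl
  rw [h, LinearMap.det_prodMap, LinearMap.det_pi, LinearMap.det_pi, abs_mul, Finset.abs_prod,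
    Finset.abs_prod, aux_norm_split]
  congr 1
  · refine Finset.prod_congr rfl fun w _ => ?_
    have : LinearMap.det (LinearMap.mulLeft ℝ (a.1 w)) = a.1 w := by
      rw [LinearMap.det_ring]; simp
    rw [this]; rfl
  · refine Finset.prod_congr rfl fun w _ => ?_
    have : LinearMap.det (LinearMap.mulLeft ℝ (a.2 w)) = ‖a.2 w‖ ^ 2 := by
      have := Algebra.norm_complex_apply (a.2 w)
      rw [Algebra.norm_apply] at this
      rw [← Complex.normSq_eq_norm_sq, ← this]; rfl
    rw [this, abs_of_nonneg (by positivity)]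

theorem aux_integral_mul {F : Type*} [NormedAddCommGroup F] [NormedSpace ℝ F]
    (a : mixedSpace K) (ha : mixedEmbedding.norm a ≠ 0) (φ : mixedSpace K → F) :
    ∫ t, φ (a * t) = (mixedEmbedding.norm a)⁻¹ • ∫ t, φ t := by
  have := aux_integral_linear volume (auxMul a ha) φ
  rw [auxMul_det] at this
  exact this

theorem aux_integrable_mul {F : Type*} [NormedAddCommGroup F]
    (a : mixedSpace K) (ha : mixedEmbedding.norm a ≠ 0) (φ : mixedSpace K → F) :
    Integrable (fun t => φ (a * t)) ↔ Integrable φ := by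
  have hdet : LinearMap.det (auxMul a ha : mixedSpace K →ₗ[ℝ] mixedSpace K) ≠ 0 :=
    (LinearEquiv.isUnit_det' (auxMul a ha).toLinearEquiv).ne_zero
  have h := Measure.map_linearMap_addHaar_eq_smul_addHaar (volume : Measure (mixedSpace K)) hdet
  have h2 := (auxMul a ha).toHomeomorph.measurableEmbedding.integrable_map_iff
    (f := (auxMul a ha).toHomeomorph) (μ := volume) (g := φ)
  have h3 : Measure.map (auxMul a ha).toHomeomorph volume =
    Measure.map (auxMul a ha : mixedSpace K →ₗ[ℝ] mixedSpace K) volume := rfl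
  rw [h3, h] at h2
  refine Iff.trans h2.symm ?_
  rw [integrable_smul_measure]
  · simpa using hdet
  · simp

theorem aux_norm_ae (K : Type*) [Field K] [NumberField K] :
    ∀ᵐ t : mixedSpace K, mixedEmbedding.norm t ≠ 0 := by
  have h : ∀ w : InfinitePlace K, ∀ᵐ t : mixedSpace K, normAtPlace w t ≠ 0 := by
    intro w
    let p : Submodule ℝ (mixedSpace K) :=
      { carrier := {t | normAtPlace w t = 0}
        add_mem' := by
          intro a b ha hb
          refine le_antisymm ((normAtPlace_add_le w a b).trans ?_) (normAtPlace_nonneg _ _)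
          rw [show normAtPlace w a = 0 from ha, show normAtPlace w b = 0 from hb, add_zero]
        zero_mem' := map_zero _
        smul_mem' := by
          intro c x hx
          change normAtPlace w (c • x) = 0
          rw [normAtPlace_smul, show normAtPlace w x = 0 from hx, mul_zero] }
    have hp : p ≠ ⊤ := by
      intro h
      have h1 : (1 : mixedSpace K) ∈ p := h ▸ Submodule.mem_top
      have h2 : normAtPlace w (1 : mixedSpace K) = 0 := h1
      rw [map_one] at h2
      exact one_ne_zero h2
    have := Measure.addHaar_submodule (volume : Measure (mixedSpace K)) p hp
    rw [ae_iff]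
    refine Eq.trans (congrArg _ ?_) this
    ext t
    simp [p]
  have := ae_all_iff.mpr h
  filter_upwards [this] with t ht
  exact mixedEmbedding.norm_ne_zero_iff.mpr ht

end MulDet

section Unfold
open MeasureTheory mixedEmbedding NumberField.InfinitePlace
open scoped Classical

variable {K : Type*} [Field K] [NumberField K]

theorem aux_countable (K : Type*) [Field K] [NumberField K] : Countable (𝓞 K) :=
  ((RingOfIntegers.basis K).equivFun.toEquiv.injective).countable

theorem aux_countable_units (K : Type*) [Field K] [NumberField K] : Countable (𝓞 K)ˣ :=
  haveI := aux_countable K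
  (Units.val_injective (α := 𝓞 K)).countable

/-- The fundamental cone. -/
abbrev auxD (K : Type*) [Field K] [NumberField K] : Set (mixedSpace K) := fundamentalCone K

theorem aux_units_hasSum {t : mixedSpace K} (ht : mixedEmbedding.norm t ≠ 0) :
    HasSum (fun u : (𝓞 K)ˣ => (auxD K).indicator (fun _ => (1 : ℝ)) (u • t))
      (Units.torsionOrder K : ℝ) := by
  obtain ⟨u0, hu0⟩ := fundamentalCone.exists_unit_smul_mem ht
  have key : ∀ u : (𝓞 K)ˣ, (u * u0) • t ∈ auxD K ↔ u ∈ Units.torsion K := by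
    intro u
    rw [mul_smul]
    exact fundamentalCone.unit_smul_mem_iff_mem_torsion hu0 u
  rw [← (Equiv.mulRight u0).hasSum_iff]
  have : ((fun u : (𝓞 K)ˣ => (auxD K).indicator (fun _ => (1 : ℝ)) (u • t)) ∘ (Equiv.mulRight u0))
      = (Units.torsion K : Set (𝓞 K)ˣ).indicator (fun _ => (1 : ℝ)) := by
    funext u
    simp only [Function.comp_apply, Equiv.coe_mulRight, Set.indicator, key, SetLike.mem_coe]
  rw [this, ← hasSum_subtype_iff_indicator]
  have : Fintype (Units.torsion K) := Fintype.ofFinite _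
  have h := hasSum_fintype (fun _ : (Units.torsion K) => (1 : ℝ))
  have h2 : ∑ _ : (Units.torsion K), (1 : ℝ) = Units.torsionOrder K := by
    rw [Units.torsionOrder, Nat.card_eq_fintype_card]; simp
  rw [h2] at h
  exact h

theorem aux_unfold (φ : mixedSpace K → ℂ) (hφ : Integrable φ) :
    HasSum (fun u : (𝓞 K)ˣ => ∫ t in auxD K, φ (mixedEmbedding K u * t))
      ((Units.torsionOrder K : ℂ) * ∫ t, φ t) := by
  have := aux_countable_units K
  have hD : MeasurableSet (auxD K) := measurableSet_fundamentalCone K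
  let F : (𝓞 K)ˣ → mixedSpace K → ℂ := fun u t =>
    (((auxD K).indicator (fun _ => (1 : ℝ)) (u • t) : ℝ) : ℂ) * φ t
  have hmeas : ∀ u : (𝓞 K)ˣ, Measurable
      (fun t : mixedSpace K => (auxD K).indicator (fun _ => (1 : ℝ)) (u • t)) := by
    intro u
    refine (measurable_const.indicator hD).comp ?_
    have : Continuous fun t : mixedSpace K => mixedEmbedding K u * t := by fun_prop
    exact this.measurable
  have hnn : ∀ (u : (𝓞 K)ˣ) (t : mixedSpace K),
      0 ≤ (auxD K).indicator (fun _ => (1 : ℝ)) (u • t) :=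
    fun u t => Set.indicator_nonneg (fun _ _ => zero_le_one) _
  have h1 : HasSum (fun u => ∫ t, F u t) (∫ t, (Units.torsionOrder K : ℂ) * φ t) := by
    refine hasSum_integral_of_dominated_convergence
      (fun u t => (auxD K).indicator (fun _ => (1 : ℝ)) (u • t) * ‖φ t‖) ?_ ?_ ?_ ?_ ?_
    · intro u
      exact (Complex.measurable_ofReal.comp (hmeas u)).aestronglyMeasurable.mul
        hφ.aestronglyMeasurable
    · intro u
      refine ae_of_all _ fun t => ?_
      simp only [F, norm_mul, Complex.norm_real, Real.norm_of_nonneg (hnn u t), le_refl]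
    · filter_upwards [aux_norm_ae K] with t ht
      exact (aux_units_hasSum ht).summable.mul_right _
    · refine (hφ.norm.const_mul (Units.torsionOrder K : ℝ)).congr ?_
      filter_upwards [aux_norm_ae K] with t ht
      rw [tsum_mul_right, (aux_units_hasSum ht).tsum_eq]
    · filter_upwards [aux_norm_ae K] with t ht
      have := (Complex.hasSum_ofReal.mpr (aux_units_hasSum ht)).mul_right (φ t)
      simpa [F] using this
  rw [integral_const_mul] at h1
  rw [← (Equiv.inv (𝓞 K)ˣ).hasSum_iff]
  refine h1.congr_fun ?_ 
  intro u
  simp only [Function.comp_apply, Equiv.inv_apply]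
  rw [← integral_indicator hD]
  have hN : mixedEmbedding.norm (mixedEmbedding K (u⁻¹ : (𝓞 K)ˣ)) = 1 := norm_unit _
  have hN0 : mixedEmbedding.norm (mixedEmbedding K (u⁻¹ : (𝓞 K)ˣ)) ≠ 0 := by rw [hN]; exact one_ne_zero
  have h2 := aux_integral_mul _ hN0 (F u)
  rw [hN, inv_one, one_smul] at h2
  rw [← h2]
  congr 1
  funext t
  have h3 : u • (mixedEmbedding K (u⁻¹ : (𝓞 K)ˣ) * t) = t := by
    change u • (u⁻¹ • t) = t
    rw [smul_smul, mul_inv_cancel, one_smul]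
  simp only [F, h3, Set.indicator]
  split_ifs <;> simp

theorem aux_norm_int (x : 𝓞 K) :
    mixedEmbedding.norm (mixedEmbedding K (x : K)) = (Ideal.absNorm (Ideal.span {x}) : ℝ) := by
  rw [norm_eq_norm, Ideal.absNorm_span_singleton, Nat.cast_natAbs, ← Algebra.coe_norm_int]
  push_cast
  rfl

theorem aux_norm_int_ne {x : 𝓞 K} (hx : x ≠ 0) :
    mixedEmbedding.norm (mixedEmbedding K (x : K)) ≠ 0 := by
  rw [aux_norm_int]
  simpa [Ideal.absNorm_eq_zero_iff] using hx

/-- Weighted function. -/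
noncomputable def auxPhi (g : mixedSpace K → ℂ) (s : ℂ) (t : mixedSpace K) : ℂ :=
  g t * (mixedEmbedding.norm t : ℂ) ^ (s - 1)

theorem auxPhi_integrable (g : mixedSpace K → ℂ) (hg : Continuous g) (hs : HasCompactSupport g)
    (s : ℂ) (h : 1 < s.re) : Integrable (auxPhi g s) := by
  refine Continuous.integrable_of_hasCompactSupport (hg.mul ?_) hs.mul_right
  exact (Complex.continuous_ofReal_cpow_const (by simpa using h)).comp
    (mixedEmbedding.continuous_norm K)

theorem auxPhi_mul (g : mixedSpace K → ℂ) (s : ℂ) (a t : mixedSpace K)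
    (ha : mixedEmbedding.norm a ≠ 0) :
    g (a * t) * (mixedEmbedding.norm t : ℂ) ^ (s - 1) =
      (mixedEmbedding.norm a : ℂ) ^ (1 - s) * auxPhi g s (a * t) := by
  rw [auxPhi, map_mul, Complex.ofReal_mul,
    Complex.mul_cpow_ofReal_nonneg (mixedEmbedding.norm_nonneg _) (mixedEmbedding.norm_nonneg _)]
  have h1 : (mixedEmbedding.norm a : ℂ) ≠ 0 := by exact_mod_cast ha
  have h2 : (mixedEmbedding.norm a : ℂ) ^ (1 - s) * (mixedEmbedding.norm a : ℂ) ^ (s - 1) = 1 := by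
    rw [← Complex.cpow_add _ _ h1]; simp
  linear_combination (-(g (a * t) * (mixedEmbedding.norm t : ℂ) ^ (s - 1))) * h2

theorem auxPhi_change (g : mixedSpace K → ℂ) (s : ℂ) (a : mixedSpace K)
    (ha : mixedEmbedding.norm a ≠ 0) :
    ∫ t, auxPhi (fun t => g (a * t)) s t =
      (mixedEmbedding.norm a : ℂ) ^ (-s) * ∫ t, auxPhi g s t := by
  have : ∀ t, auxPhi (fun t => g (a * t)) s t =
      (mixedEmbedding.norm a : ℂ) ^ (1 - s) * auxPhi g s (a * t) := fun t => auxPhi_mul g s a t ha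
  simp_rw [this]
  rw [integral_const_mul, aux_integral_mul a ha (auxPhi g s)]
  have h1 : (mixedEmbedding.norm a : ℂ) ≠ 0 := by exact_mod_cast ha
  rw [sub_eq_add_neg, Complex.cpow_add _ _ h1, Complex.cpow_one, Complex.real_smul]
  push_cast
  field_simp

theorem aux_unfold_elt (g : mixedSpace K → ℂ) (hg : Continuous g) (hs : HasCompactSupport g)
    (s : ℂ) (h : 1 < s.re) (x : 𝓞 K) (hx : x ≠ 0) :
    HasSum (fun u : (𝓞 K)ˣ => ∫ t in auxD K, g (mixedEmbedding K ((u * x : 𝓞 K) : K) * t) *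
        (mixedEmbedding.norm t : ℂ) ^ (s - 1))
      ((Units.torsionOrder K : ℂ) * ((Ideal.absNorm (Ideal.span {x}) : ℂ) ^ (-s) *
        ∫ t, auxPhi g s t)) := by
  have hN := aux_norm_int_ne hx
  have h1 := aux_unfold (auxPhi (fun t => g (mixedEmbedding K (x : K) * t)) s) (by
    refine auxPhi_integrable _ (by fun_prop) ?_ s h
    exact hs.comp_homeomorph (auxMul _ hN).toHomeomorph)
  rw [auxPhi_change g s _ hN, aux_norm_int, Complex.ofReal_natCast] at h1
  refine h1.congr_fun fun u => ?_
  congr 1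
  funext t
  rw [auxPhi, map_mul mixedEmbedding.norm, norm_unit, one_mul]
  congr 2
  rw [← mul_assoc, ← map_mul, mul_comm (x : K)]
  rfl

end Unfold

section UnfoldAll
open MeasureTheory mixedEmbedding NumberField.InfinitePlace
open scoped Classical

variable {K : Type*} [Field K] [NumberField K]

theorem aux_hasSum_conv {ι : Type*} {f f' : ι → ℂ} {a a' : ℂ} (h : HasSum f a)
    (hf : ∀ i, f' i = f i) (ha : a' = a) : HasSum f' a' := by
  rw [ha, funext hf]; exact h

theorem aux_mk0_mul (I J : Ideal (𝓞 K)) (hI : I ∈ nonZeroDivisors (Ideal (𝓞 K)))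
    (hJ : J ∈ nonZeroDivisors (Ideal (𝓞 K))) :
    ClassGroup.mk0 (⟨I * J, mul_mem hI hJ⟩ : nonZeroDivisors (Ideal (𝓞 K))) =
      ClassGroup.mk0 ⟨I, hI⟩ * ClassGroup.mk0 ⟨J, hJ⟩ :=
  map_mul ClassGroup.mk0 (⟨I, hI⟩ : nonZeroDivisors (Ideal (𝓞 K))) ⟨J, hJ⟩

theorem aux_class (K : Type*) [Field K] [NumberField K] :
    ∃ (J : ClassGroup (𝓞 K) → Ideal (𝓞 K))
      (Φ : {I : Ideal (𝓞 K) // I ≠ ⊥} → ClassGroup (𝓞 K) × 𝓞 K),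
      (∀ c, J c ≠ ⊥) ∧ (∀ I, (Φ I).2 ≠ 0) ∧
      (∀ I, Ideal.span {(Φ I).2} = I.1 * J (Φ I).1) ∧
      (∀ c x, x ∈ J c → x ≠ 0 → ∃ I u, (Φ I).1 = c ∧ ((u : (𝓞 K)ˣ) : 𝓞 K) * (Φ I).2 = x) := by
  choose J hJ using ClassGroup.mk0_surjective (R := 𝓞 K)
  have hmem : ∀ I : {I : Ideal (𝓞 K) // I ≠ ⊥}, I.1 ∈ nonZeroDivisors (Ideal (𝓞 K)) :=
    fun I => mem_nonZeroDivisors_iff_ne_zero.mpr I.2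
  have hp : ∀ I : {I : Ideal (𝓞 K) // I ≠ ⊥}, ∃ x : 𝓞 K,
      Ideal.span {x} = I.1 * (J (ClassGroup.mk0 ⟨I.1, hmem I⟩)⁻¹ : Ideal (𝓞 K)) := by
    intro I
    have h1 : ClassGroup.mk0 (⟨I.1 * (J (ClassGroup.mk0 ⟨I.1, hmem I⟩)⁻¹ : Ideal (𝓞 K)),
        mul_mem (hmem I) (J (ClassGroup.mk0 ⟨I.1, hmem I⟩)⁻¹).2⟩) = 1 := by
      rw [aux_mk0_mul _ _ (hmem I) (J (ClassGroup.mk0 ⟨I.1, hmem I⟩)⁻¹).2, hJ, mul_inv_cancel]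
    have h2 := (ClassGroup.mk0_eq_one_iff _).mp h1
    obtain ⟨x, hx⟩ := h2
    exact ⟨x, hx.symm⟩
  choose x hx using hp
  refine ⟨fun c => J c, fun I => ((ClassGroup.mk0 ⟨I.1, hmem I⟩)⁻¹, x I), ?_, ?_, hx, ?_⟩
  · intro c
    exact nonZeroDivisors.coe_ne_zero (J c)
  · intro I h
    have := hx I
    simp only at h
    rw [h] at this
    have h3 : I.1 * (J (ClassGroup.mk0 ⟨I.1, hmem I⟩)⁻¹ : Ideal (𝓞 K)) = 0 := by
      rw [← this]; simp
    rcases mul_eq_zero.mp h3 with h4 | h4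
    · exact I.2 h4
    · exact nonZeroDivisors.coe_ne_zero _ h4
  · intro c y hy hy0
    have hle : Ideal.span {y} ≤ (J c : Ideal (𝓞 K)) := by
      rw [Ideal.span_le]; simpa using hy
    obtain ⟨I, hI⟩ := Ideal.dvd_iff_le.mpr hle
    have hI0 : I ≠ ⊥ := by
      rintro rfl
      rw [Ideal.mul_bot, Ideal.span_singleton_eq_bot] at hI
      exact hy0 hI
    have hc : (ClassGroup.mk0 ⟨I, hmem ⟨I, hI0⟩⟩)⁻¹ = c := by
      have : ClassGroup.mk0 ⟨(J c : Ideal (𝓞 K)) * I, mul_mem (J c).2 (hmem ⟨I, hI0⟩)⟩ = 1 := by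
        rw [ClassGroup.mk0_eq_one_iff]
        exact ⟨y, hI.symm⟩
      rw [aux_mk0_mul _ _ (J c).2 (hmem ⟨I, hI0⟩), hJ] at this
      exact inv_eq_of_mul_eq_one_left this
    have has : Associated (x ⟨I, hI0⟩) y := by
      rw [← Ideal.span_singleton_eq_span_singleton, hx, hI, hc, mul_comm]
    obtain ⟨u, hu⟩ := has
    refine ⟨⟨I, hI0⟩, u, hc, ?_⟩
    rw [mul_comm]; exact hu

set_option maxHeartbeats 1600000 in
theorem aux_unfold_all (Z : ℂ → ℂ)
    (hZ : ∀ s : ℂ, 1 < s.re →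
      HasSum (fun I : {I : Ideal (𝓞 K) // I ≠ ⊥} =>
        (Ideal.absNorm I.1 : ℂ) ^ (-s)) (Z s)) :
    ∃ J : ClassGroup (𝓞 K) → Ideal (𝓞 K), (∀ c, J c ≠ ⊥) ∧
      ∀ g : mixedSpace K → ℂ, Continuous g → HasCompactSupport g → ∀ s : ℂ, 1 < s.re →
        ∑ c, (Ideal.absNorm (J c) : ℂ) ^ s * ∫ t in auxD K,
          (∑' x : 𝓞 K, if x ∈ J c ∧ x ≠ 0 then g (mixedEmbedding K (x : K) * t) else 0) *
            (mixedEmbedding.norm t : ℂ) ^ (s - 1) =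
        (Units.torsionOrder K : ℂ) * Z s * ∫ t, auxPhi g s t := by
  have := aux_countable K
  obtain ⟨J, Φ, hJ, hΦ0, hΦ, hΦs⟩ := aux_class K
  refine ⟨J, hJ, fun g hg hgs s hs => ?_⟩
  have hD : MeasurableSet (auxD K) := measurableSet_fundamentalCone K
  have hJpos : ∀ c, 0 < (Ideal.absNorm (J c) : ℝ) := fun c => by
    have : Ideal.absNorm (J c) ≠ 0 := by
      rw [Ne, Ideal.absNorm_eq_zero_iff]; exact hJ c
    exact_mod_cast Nat.pos_of_ne_zero this
  let Ψ : {I : Ideal (𝓞 K) // I ≠ ⊥} × (𝓞 K)ˣ → ClassGroup (𝓞 K) × 𝓞 K :=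
    fun p => ((Φ p.1).1, p.2 * (Φ p.1).2)
  have hspan : ∀ p, Ideal.span {(Ψ p).2} = p.1.1 * J (Ψ p).1 := by
    intro p
    rw [← hΦ p.1, Ideal.span_singleton_eq_span_singleton]
    exact ⟨p.2⁻¹, by simp only [Ψ]; rw [mul_right_comm, Units.mul_inv, one_mul]⟩
  have hΨinj : Function.Injective Ψ := by
    rintro ⟨I, u⟩ ⟨I', u'⟩ h
    have h1 := hspan (I, u)
    rw [h, hspan (I', u')] at h1
    have h2 : I' = I := Subtype.ext (mul_right_cancel₀ (hJ _) h1)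
    subst h2
    have h3 : (u : 𝓞 K) * (Φ I').2 = u' * (Φ I').2 := congrArg Prod.snd h
    have h4 := mul_right_cancel₀ (hΦ0 _) h3
    rw [Units.ext h4]
  have hΨrange : ∀ p : ClassGroup (𝓞 K) × 𝓞 K, p ∉ Set.range Ψ → ¬ (p.2 ∈ J p.1 ∧ p.2 ≠ 0) := by
    rintro ⟨c, x⟩ hp ⟨h1, h2⟩
    obtain ⟨I, u, h3, h4⟩ := hΦs c x h1 h2
    exact hp ⟨(I, u), Prod.ext h3 h4⟩
  have hΨmem : ∀ p, (Ψ p).2 ∈ J (Ψ p).1 ∧ (Ψ p).2 ≠ 0 := by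
    intro p
    refine ⟨?_, mul_ne_zero p.2.ne_zero (hΦ0 _)⟩
    have : (Ψ p).2 ∈ Ideal.span {(Ψ p).2} := Ideal.mem_span_singleton_self _
    rw [hspan] at this
    exact (Ideal.mul_le_right : p.1.1 * J (Ψ p).1 ≤ J (Ψ p).1) this
  -- the norm identity
  have hNrm : ∀ (s : ℂ) (I : {I : Ideal (𝓞 K) // I ≠ ⊥}),
      (Ideal.absNorm (J (Φ I).1) : ℂ) ^ s * (Ideal.absNorm (Ideal.span {(Φ I).2}) : ℂ) ^ (-s)
        = (Ideal.absNorm I.1 : ℂ) ^ (-s) := by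
    intro s I
    rw [hΦ, map_mul, Nat.cast_mul, Complex.natCast_mul_natCast_cpow]
    have h1 : (Ideal.absNorm (J (Φ I).1) : ℂ) ≠ 0 := by
      exact_mod_cast (hJpos _).ne'
    rw [mul_left_comm, ← Complex.cpow_add _ _ h1]
    simp
  -- main terms
  let A : (mixedSpace K → ℂ) → ℂ → 𝓞 K → ℂ := fun g s x =>
    ∫ t in auxD K, g (mixedEmbedding K (x : K) * t) * (mixedEmbedding.norm t : ℂ) ^ (s - 1)
  have hA : ∀ g : mixedSpace K → ℂ, Continuous g → HasCompactSupport g → ∀ s : ℂ, 1 < s.re →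
      ∀ I, HasSum (fun u : (𝓞 K)ˣ => (Ideal.absNorm (J (Ψ (I, u)).1) : ℂ) ^ s * A g s (Ψ (I, u)).2)
        ((Units.torsionOrder K : ℂ) * (∫ t, auxPhi g s t) * (Ideal.absNorm I.1 : ℂ) ^ (-s)) := by
    intro g hg hgs s hs I
    have h := (aux_unfold_elt g hg hgs s hs (Φ I).2 (hΦ0 I)).mul_left
      ((Ideal.absNorm (J (Φ I).1) : ℂ) ^ s)
    refine aux_hasSum_conv h (fun _ => rfl) ?_
    rw [← hNrm]; ring
  let B : 𝓞 K → ℝ := fun x => ∫ t in auxD K,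
    ‖g (mixedEmbedding K (x : K) * t) * (mixedEmbedding.norm t : ℂ) ^ (s - 1)‖
  let σ : ℝ := s.re
  have hσ : 1 < (σ : ℂ).re := hs
  let g' : mixedSpace K → ℂ := fun t => (‖g t‖ : ℂ)
  have hg' : Continuous g' := by fun_prop
  have hgs' : HasCompactSupport g' := by
    have : g' = (fun z : ℂ => (‖z‖ : ℂ)) ∘ g := rfl
    rw [this]; exact hgs.comp_left (by simp)
  have hAB : ∀ x, A g' σ x = (B x : ℂ) := by
    intro x
    simp only [A, B]
    rw [← integral_complex_ofReal]
    refine setIntegral_congr_fun hD fun t ht => ?_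
    have hpos := fundamentalCone.norm_pos_of_mem ht
    simp only [g', norm_mul, Complex.ofReal_mul]
    congr 1
    rw [Complex.norm_cpow_eq_rpow_re_of_pos hpos, Complex.ofReal_cpow hpos.le]
    simp [σ]
  have hBnn : ∀ x, 0 ≤ B x := fun x => integral_nonneg fun t => norm_nonneg _
  let P : ClassGroup (𝓞 K) × 𝓞 K → ℝ := fun p => (Ideal.absNorm (J p.1) : ℝ) ^ σ * B p.2
  have hPnn : ∀ p, 0 ≤ P p := fun p => mul_nonneg (Real.rpow_nonneg (hJpos _).le _) (hBnn _)
  have hPC : ∀ p, (P p : ℂ) = (Ideal.absNorm (J p.1) : ℂ) ^ (σ : ℂ) * A g' σ p.2 := by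
    intro p
    rw [hAB]
    simp only [P]
    rw [Complex.ofReal_mul, Complex.ofReal_cpow (hJpos _).le]
    simp
  have hPsum : Summable fun p => P (Ψ p) := by
    rw [summable_prod_of_nonneg (fun p => hPnn _)]
    have h1 := fun I => hA g' hg' hgs' σ hσ I
    simp_rw [← hPC] at h1
    constructor
    · intro I
      exact Complex.summable_ofReal.mp (h1 I).summable
    · rw [← Complex.summable_ofReal]
      simp_rw [Complex.ofReal_tsum, fun I => (h1 I).tsum_eq]
      exact ((hZ σ hσ).summable).mul_left _
  have hle : ∀ p, ‖(Ideal.absNorm (J p.1) : ℂ) ^ s * A g s p.2‖ ≤ P p := by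
    intro p
    rw [norm_mul]
    have h1 : ‖(Ideal.absNorm (J p.1) : ℂ) ^ s‖ = (Ideal.absNorm (J p.1) : ℝ) ^ σ := by
      have := Complex.norm_cpow_eq_rpow_re_of_pos (hJpos p.1) s
      simpa using this
    rw [h1]
    exact mul_le_mul_of_nonneg_left (norm_integral_le_integral_norm _)
      (Real.rpow_nonneg (hJpos _).le _)
  have hsumA : Summable fun p => (Ideal.absNorm (J (Ψ p).1) : ℂ) ^ s * A g s (Ψ p).2 :=
    Summable.of_norm_bounded hPsum fun p => hle _
  have hval := hsumA.hasSum.prod_fiberwise (hA g hg hgs s hs)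
  have hval2 := (hZ s hs).mul_left ((Units.torsionOrder K : ℂ) * (∫ t, auxPhi g s t))
  have heq := hval.unique hval2
  have hsum := hsumA.hasSum
  rw [heq] at hsum
  let f : ClassGroup (𝓞 K) × 𝓞 K → ℂ := fun p =>
    if p.2 ∈ J p.1 ∧ p.2 ≠ 0 then (Ideal.absNorm (J p.1) : ℂ) ^ s * A g s p.2 else 0
  have hf : HasSum f ((Units.torsionOrder K : ℂ) * (∫ t, auxPhi g s t) * Z s) := by
    rw [← hΨinj.hasSum_iff (fun p hp => if_neg (hΨrange p hp))]
    refine hsum.congr_fun fun p => ?_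
    exact if_pos (hΨmem p)
  let fr : ClassGroup (𝓞 K) × 𝓞 K → ℝ := fun p =>
    if p.2 ∈ J p.1 ∧ p.2 ≠ 0 then P p else 0
  have hfr : Summable fr := by
    rw [← hΨinj.summable_iff (fun p hp => if_neg (hΨrange p hp))]
    refine hPsum.congr fun p => ?_
    exact (if_pos (hΨmem p)).symm
  have hfin := hf.prod_fiberwise (g := fun c => (Ideal.absNorm (J c) : ℂ) ^ s * ∫ t in auxD K,
          (∑' x : 𝓞 K, if x ∈ J c ∧ x ≠ 0 then g (mixedEmbedding K (x : K) * t) else 0) *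
            (mixedEmbedding.norm t : ℂ) ^ (s - 1)) (by
    intro c
    let F : 𝓞 K → mixedSpace K → ℂ := fun x t =>
      if x ∈ J c ∧ x ≠ 0 then g (mixedEmbedding K (x : K) * t) *
        (mixedEmbedding.norm t : ℂ) ^ (s - 1) else 0
    have hFint : ∀ x, Integrable (F x) (volume.restrict (auxD K)) := by
      intro x
      by_cases hx : x ∈ J c ∧ x ≠ 0
      · have h1 : F x = auxPhi (fun t => g (mixedEmbedding K (x : K) * t)) s := by
          funext t; exact if_pos hx
        rw [h1]
        refine (auxPhi_integrable _ (by fun_prop) ?_ s hs).restrict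
        exact hgs.comp_homeomorph (auxMul _ (aux_norm_int_ne hx.2)).toHomeomorph
      · have h1 : F x = 0 := by
          funext t; exact if_neg hx
        rw [h1]; exact integrable_zero _ _ _
    have hFsum : Summable fun x => ∫ t in auxD K, ‖F x t‖ := by
      have h1 := (hfr.prod_factor c).mul_left ((Ideal.absNorm (J c) : ℝ) ^ σ)⁻¹
      refine h1.congr fun x => ?_
      by_cases hx : x ∈ J c ∧ x ≠ 0
      · have h2 : ∀ t, F x t = g (mixedEmbedding K (x : K) * t) *
          (mixedEmbedding.norm t : ℂ) ^ (s - 1) := fun t => if_pos hx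
        simp only [fr, h2, if_pos hx, P]
        rw [inv_mul_cancel_left₀ (Real.rpow_pos_of_pos (hJpos c) _).ne']
      · have h2 : ∀ t, F x t = 0 := fun t => if_neg hx
        simp [fr, h2, if_neg hx]
    have h3 := (hasSum_integral_of_summable_integral_norm hFint hFsum).mul_left
      ((Ideal.absNorm (J c) : ℂ) ^ s)
    refine aux_hasSum_conv h3 ?_ ?_
    · intro x
      by_cases hx : x ∈ J c ∧ x ≠ 0
      · have h2 : ∀ t, F x t = g (mixedEmbedding K (x : K) * t) *
          (mixedEmbedding.norm t : ℂ) ^ (s - 1) := fun t => if_pos hx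
        simp only [f, h2, if_pos hx, A]
      · have h2 : ∀ t, F x t = 0 := fun t => if_neg hx
        simp [f, h2, if_neg hx]
    · congr 2
      funext t
      rw [← tsum_mul_right]
      congr 1
      funext x
      simp only [F]
      split_ifs <;> simp)
  have h5 := (hasSum_fintype _).unique hfin
  rw [h5]; ring

end UnfoldAll

section Decay
open MeasureTheory mixedEmbedding NumberField.InfinitePlace
open scoped Classical

variable {K : Type*} [Field K] [NumberField K]

theorem aux_basis (J : Ideal (𝓞 K)) (hJ : J ≠ ⊥) :
    ∃ (n : ℕ) (B : Module.Basis (Fin n) ℝ (mixedSpace K)) (θ : (Fin n → ℤ) → 𝓞 K),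
      Function.Injective θ ∧ (Set.range θ = (J : Set (𝓞 K))) ∧
      ∀ m, mixedEmbedding K (θ m : K) = ∑ i, (m i : ℝ) • B i := by
  let I : (FractionalIdeal (nonZeroDivisors (𝓞 K)) K)ˣ :=
    Units.mk0 (J : FractionalIdeal (nonZeroDivisors (𝓞 K)) K) (FractionalIdeal.coeIdeal_ne_zero.mpr hJ)
  let ι := Module.Free.ChooseBasisIndex ℤ I
  let B0 := fractionalIdealLatticeBasis K I
  let e := Fintype.equivFin ι
  let B := B0.reindex e
  have hspan : ∀ m : Fin (Fintype.card ι) → ℤ, ∃ x : 𝓞 K, x ∈ J ∧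
      mixedEmbedding K (x : K) = ∑ i, (m i : ℝ) • B i := by
    intro m
    have h1 : ∑ i, (m i : ℝ) • B i ∈ Submodule.span ℤ (Set.range B0) := by
      refine Submodule.sum_mem _ fun i _ => ?_
      rw [Int.cast_smul_eq_zsmul]
      exact Submodule.smul_mem _ _ (Submodule.subset_span ⟨e.symm i, by simp [B]⟩)
    rw [mem_span_fractionalIdealLatticeBasis] at h1
    obtain ⟨y, hy, hy2⟩ := h1
    obtain ⟨x, hx, hx2⟩ := (FractionalIdeal.mem_coeIdeal _).mp hy
    exact ⟨x, hx, by rw [← hy2, ← hx2]⟩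
  choose θ hθ hθ2 using hspan
  refine ⟨_, B, θ, ?_, ?_, hθ2⟩
  · intro m m' h
    have h1 := hθ2 m
    rw [h, hθ2 m'] at h1
    have h2 := congrArg B.equivFun h1
    rw [← B.equivFun_symm_apply, ← B.equivFun_symm_apply, LinearEquiv.apply_symm_apply,
      LinearEquiv.apply_symm_apply] at h2
    funext i
    have := congrFun h2 i
    exact_mod_cast this.symm
  · ext x
    constructor
    · rintro ⟨m, rfl⟩; exact hθ m
    · intro hx
      have h1 : mixedEmbedding K (x : K) ∈ Submodule.span ℤ (Set.range B0) := by
        rw [mem_span_fractionalIdealLatticeBasis]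
        exact ⟨x, (FractionalIdeal.mem_coeIdeal _).mpr ⟨x, hx, rfl⟩, rfl⟩
      rw [Submodule.mem_span_range_iff_exists_fun] at h1
      obtain ⟨c, hc⟩ := h1
      refine ⟨fun i => c (e.symm i), ?_⟩
      apply RingOfIntegers.coe_injective
      apply mixedEmbedding_injective K
      rw [hθ2, ← hc, ← e.symm.sum_comp]
      refine Finset.sum_congr rfl fun i _ => ?_
      rw [Int.cast_smul_eq_zsmul]
      simp [B]

theorem aux_cone_bound (K : Type*) [Field K] [NumberField K] :
    ∃ R : ℝ, 0 ≤ R ∧ ∀ t ∈ auxD K,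
      ‖t‖ ≤ R * (mixedEmbedding.norm t) ^ ((Module.finrank ℚ K : ℝ)⁻¹) := by
  obtain ⟨R, hR⟩ := (fundamentalCone.isBounded_normLeOne K).exists_norm_le
  refine ⟨max R 0, le_max_right _ _, fun t ht => ?_⟩
  have hn : (Module.finrank ℚ K) ≠ 0 := Module.finrank_pos.ne'
  have hpos := fundamentalCone.norm_pos_of_mem ht
  set r := (mixedEmbedding.norm t) ^ ((Module.finrank ℚ K : ℝ)⁻¹) with hr
  have hrpos : 0 < r := Real.rpow_pos_of_pos hpos _
  have h1 : r⁻¹ • t ∈ fundamentalCone.normLeOne K := by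
    rw [fundamentalCone.mem_normLeOne]
    refine ⟨fundamentalCone.smul_mem_of_mem ht (inv_ne_zero hrpos.ne'), ?_⟩
    rw [mixedEmbedding.norm_smul, abs_of_pos (inv_pos.mpr hrpos), inv_pow, hr,
      Real.rpow_inv_natCast_pow hpos.le hn, inv_mul_cancel₀ hpos.ne']
  have h2 := hR _ h1
  rw [_root_.norm_smul, Real.norm_of_nonneg (inv_pos.mpr hrpos).le, inv_mul_le_iff₀ hrpos, mul_comm] at h2
  exact h2.trans (by gcongr; exact le_max_left _ _)

theorem aux_decay (J : Ideal (𝓞 K)) (hJ : J ≠ ⊥) (g : mixedSpace K → ℂ)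
    (hg : ContDiff ℝ (⊤ : ℕ∞) g) (hs : HasCompactSupport g) (h0 : ∫ x, g x = 0) (hg0 : g 0 = 0)
    (κ : ℝ) (R : ℝ) :
    ∃ C : ℝ, 0 ≤ C ∧ ∀ t ∈ auxD K, mixedEmbedding.norm t ≤ R →
      ‖∑' x : 𝓞 K, if x ∈ J ∧ x ≠ 0 then g (mixedEmbedding K (x : K) * t) else 0‖ ≤
        C * (mixedEmbedding.norm t) ^ κ := by
  obtain ⟨n, B, θ, hθi, hθr, hθ⟩ := aux_basis J hJ
  obtain ⟨R1, hR1, hcone⟩ := aux_cone_bound K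
  let V := EuclideanSpace ℝ (Fin n)
  let L : V ≃L[ℝ] mixedSpace K :=
    ((EuclideanSpace.equiv (Fin n) ℝ).toLinearEquiv.trans B.equivFun.symm).toContinuousLinearEquiv
  have hL : ∀ m : Fin n → ℤ, L (WithLp.toLp 2 (auxCast m)) = mixedEmbedding K (θ m : K) := by
    intro m
    rw [hθ]
    change B.equivFun.symm (auxCast m) = _
    rw [B.equivFun_symm_apply]
    rfl
  let G : V → ℂ := fun v => g (L v)
  have hG : ContDiff ℝ (⊤ : ℕ∞) G := hg.comp L.contDiff
  have hGs : HasCompactSupport G := hs.comp_homeomorph L.toHomeomorph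
  have hG0 : ∫ v, G v = 0 := by
    have h1 : ∫ v, G v = ∫ x, g x ∂(Measure.map L volume) :=
      (L.toHomeomorph.measurableEmbedding.integral_map g).symm
    have : (Measure.map L (volume : Measure V)).IsAddHaarMeasure :=
      L.isAddHaarMeasure_map volume
    rw [h1, Measure.isAddLeftInvariant_eq_smul (Measure.map L (volume : Measure V)) volume]
    rw [integral_smul_nnreal_measure, h0, smul_zero]
  let d : ℝ := Module.finrank ℚ K
  have hd : 0 < d := by
    show (0 : ℝ) < (Module.finrank ℚ K : ℝ)
    exact Nat.cast_pos.mpr Module.finrank_pos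
  obtain ⟨M, hM1⟩ := exists_nat_gt (max (n : ℝ) (d * (κ + 1)))
  have hMn : Fintype.card (Fin n) < M := by
    rw [Fintype.card_fin]
    exact_mod_cast lt_of_le_of_lt (le_max_left _ _) hM1
  have hMκ : κ + 1 ≤ d⁻¹ * M := by
    rw [le_inv_mul_iff₀ hd]
    exact (lt_of_le_of_lt (le_max_right _ _) hM1).le
  obtain ⟨C0, hC0, hbd⟩ := aux_lattice_bound G hG hGs hG0 M hMn
  let c1 : ℝ := ‖(L.symm : mixedSpace K →L[ℝ] V)‖ * ‖(L : V →L[ℝ] mixedSpace K)‖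
  have hc1 : 0 ≤ c1 := by positivity
  refine ⟨C0 * (c1 * R1) ^ M * (max R 0) ^ (d⁻¹ * M - 1 - κ), by positivity, fun t ht hNR => ?_⟩
  have hpos := fundamentalCone.norm_pos_of_mem ht
  set N := mixedEmbedding.norm t with hN
  -- rewrite the sum
  have hsum : (∑' x : 𝓞 K, if x ∈ J ∧ x ≠ 0 then g (mixedEmbedding K (x : K) * t) else 0) =
      ∑' m : Fin n → ℤ, g (mixedEmbedding K (θ m : K) * t) := by
    have e1 : ∀ x : 𝓞 K, (if x ∈ J ∧ x ≠ 0 then g (mixedEmbedding K (x : K) * t) else 0) =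
        if x ∈ J then g (mixedEmbedding K (x : K) * t) else 0 := by
      intro x
      by_cases hx : x = 0
      · subst hx; simp [hg0]
      · simp [hx]
    simp_rw [e1]
    rw [← hθi.tsum_eq]
    · refine tsum_congr fun m => ?_
      rw [if_pos]
      have : θ m ∈ Set.range θ := ⟨m, rfl⟩
      rw [hθr] at this
      exact this
    · intro x hx
      rw [hθr]
      by_contra h
      exact hx (if_neg h)
  let T : V ≃L[ℝ] V := (L.trans (auxMul t hpos.ne')).trans L.symm
  have hT : ∀ m : Fin n → ℤ, g (mixedEmbedding K (θ m : K) * t) =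
      G (T (WithLp.toLp 2 (auxCast m))) := by
    intro m
    simp only [G, T, ContinuousLinearEquiv.trans_apply, ContinuousLinearEquiv.apply_symm_apply,
      hL, auxMul_apply]
    rw [mul_comm]
  have hdet : |LinearMap.det (T : V →ₗ[ℝ] V)| = N := by
    have := LinearMap.det_conj (auxMul t hpos.ne' : mixedSpace K →ₗ[ℝ] mixedSpace K)
      L.symm.toLinearEquiv
    rw [hN, ← auxMul_det t hpos.ne', ← this]
    rfl
  have hTn : ‖(T : V →L[ℝ] V)‖ ≤ c1 * R1 * N ^ d⁻¹ := by
    have h1 : (T : V →L[ℝ] V) = (L.symm : mixedSpace K →L[ℝ] V).comp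
      ((auxMul t hpos.ne' : mixedSpace K →L[ℝ] mixedSpace K).comp (L : V →L[ℝ] mixedSpace K)) := rfl
    have h2 : ‖(auxMul t hpos.ne' : mixedSpace K →L[ℝ] mixedSpace K)‖ ≤ ‖t‖ :=
      ContinuousLinearMap.opNorm_le_bound _ (norm_nonneg _) fun x => norm_mul_le t x
    rw [h1]
    calc _ ≤ ‖(L.symm : mixedSpace K →L[ℝ] V)‖ *
          (‖(auxMul t hpos.ne' : mixedSpace K →L[ℝ] mixedSpace K)‖ * ‖(L : V →L[ℝ] mixedSpace K)‖) :=
        (ContinuousLinearMap.opNorm_comp_le _ _).trans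
          (mul_le_mul_of_nonneg_left (ContinuousLinearMap.opNorm_comp_le _ _) (norm_nonneg _))
      _ ≤ ‖(L.symm : mixedSpace K →L[ℝ] V)‖ *
          ((R1 * N ^ d⁻¹) * ‖(L : V →L[ℝ] mixedSpace K)‖) := by
        gcongr
        exact h2.trans (hcone t ht)
      _ = _ := by simp only [c1]; ring
  rw [hsum]
  simp_rw [hT]
  refine (hbd T).trans ?_
  rw [hdet]
  have hRN : N ^ (d⁻¹ * M - 1 - κ) ≤ (max R 0) ^ (d⁻¹ * M - 1 - κ) :=
    Real.rpow_le_rpow hpos.le (hNR.trans (le_max_left _ _)) (by linarith)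
  calc C0 * N⁻¹ * ‖(T : V →L[ℝ] V)‖ ^ M ≤ C0 * N⁻¹ * (c1 * R1 * N ^ d⁻¹) ^ M := by gcongr
    _ = C0 * (c1 * R1) ^ M * (N ^ (d⁻¹ * M - 1 - κ) * N ^ κ) := by
      rw [mul_pow, ← Real.rpow_add hpos, ← Real.rpow_natCast (N ^ d⁻¹), ← Real.rpow_mul hpos.le,
        ← Real.rpow_neg_one N]
      rw [show d⁻¹ * (M : ℝ) - 1 - κ + κ = -1 + d⁻¹ * M by ring, Real.rpow_add hpos]
      ring
    _ ≤ C0 * (c1 * R1) ^ M * ((max R 0) ^ (d⁻¹ * M - 1 - κ) * N ^ κ) := by gcongr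
    _ = _ := by ring

theorem aux_vanish (J : Ideal (𝓞 K)) (g : mixedSpace K → ℂ) (hs : HasCompactSupport g) :
    ∃ R : ℝ, 0 ≤ R ∧ ∀ t : mixedSpace K, R < mixedEmbedding.norm t →
      (∑' x : 𝓞 K, if x ∈ J ∧ x ≠ 0 then g (mixedEmbedding K (x : K) * t) else 0) = 0 := by
  obtain ⟨R, hR⟩ := (hs.isCompact.image (mixedEmbedding.continuous_norm K)).isBounded.exists_norm_le
  refine ⟨max R 0, le_max_right _ _, fun t ht => ?_⟩
  refine (tsum_congr fun x => ?_).trans tsum_zero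
  split_ifs with hx
  · by_contra hne
    have h1 : mixedEmbedding K (x : K) * t ∈ tsupport g := subset_tsupport g hne
    have h2 := hR _ ⟨_, h1, rfl⟩
    rw [map_mul, Real.norm_of_nonneg
      (mul_nonneg (mixedEmbedding.norm_nonneg _) (mixedEmbedding.norm_nonneg _))] at h2
    have h3 := aux_norm_int_ne hx.2
    rw [aux_norm_int] at h2 h3
    have h4 : (1 : ℝ) ≤ (Ideal.absNorm (Ideal.span {x}) : ℝ) := by
      have : Ideal.absNorm (Ideal.span {x}) ≠ 0 := by exact_mod_cast h3
      exact_mod_cast Nat.one_le_iff_ne_zero.mpr this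
    have h5 := mixedEmbedding.norm_nonneg t
    have h6 : mixedEmbedding.norm t ≤ R := by nlinarith
    exact absurd ht (not_lt.mpr (h6.trans (le_max_left _ _)))
  · rfl

end Decay

section Holo
open MeasureTheory

theorem aux_log_bound {x τ ε R : ℝ} (hx : 0 < x) (hxR : x ≤ R) (hR : 1 ≤ R) (hε : 0 < ε)
    (h1 : ε ≤ τ) (h2 : τ ≤ 4 * ε) : |Real.log x| * x ^ τ ≤ 2 * R ^ (5 * ε) / ε := by
  have a1 : Real.log x ≤ x ^ ε / ε := Real.log_le_rpow_div hx.le hε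
  have a2 : Real.log x⁻¹ ≤ x⁻¹ ^ ε / ε := Real.log_le_rpow_div (inv_pos.mpr hx).le hε
  rw [Real.log_inv, Real.inv_rpow hx.le, ← Real.rpow_neg hx.le] at a2
  have p1 : 0 < x ^ ε := Real.rpow_pos_of_pos hx _
  have p2 : 0 < x ^ (-ε) := Real.rpow_pos_of_pos hx _
  have a3 : |Real.log x| ≤ x ^ ε / ε + x ^ (-ε) / ε := by
    have q1 : 0 < x ^ ε / ε := by positivity
    have q2 : 0 < x ^ (-ε) / ε := by positivity
    rw [abs_le]; constructor <;> linarith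
  have key : ∀ e : ℝ, 0 ≤ e → e ≤ 5 * ε → x ^ e ≤ R ^ (5 * ε) := fun e he he' =>
    (Real.rpow_le_rpow hx.le hxR he).trans (Real.rpow_le_rpow_of_exponent_le hR he')
  calc |Real.log x| * x ^ τ ≤ (x ^ ε / ε + x ^ (-ε) / ε) * x ^ τ := by gcongr
    _ = (x ^ (ε + τ) + x ^ (-ε + τ)) / ε := by
      rw [Real.rpow_add hx, Real.rpow_add hx]; ring
    _ ≤ (R ^ (5 * ε) + R ^ (5 * ε)) / ε := by
      gcongr
      · exact key _ (by linarith) (by linarith)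
      · exact key _ (by linarith) (by linarith)
    _ = _ := by ring

theorem aux_holo {α : Type*} [MeasurableSpace α] (μ : Measure α) (f : α → ℂ) (N : α → ℝ)
    (hN : Measurable N) (hpos : ∀ᵐ t ∂μ, 0 < N t) (hf : AEStronglyMeasurable f μ)
    (A : Set α) (hA : MeasurableSet A) (hAμ : μ A ≠ ⊤) (C κ R : ℝ)
    (hC : ∀ᵐ t ∂μ, ‖f t‖ ≤ C * N t ^ κ) (hsupp : ∀ᵐ t ∂μ, f t ≠ 0 → t ∈ A ∧ N t ≤ R) :
    DifferentiableOn ℂ (fun s : ℂ => ∫ t, f t * (N t : ℂ) ^ (s - 1) ∂μ) {s | 1 - κ < s.re} := by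
  intro s₀ hs₀
  have hs₀ : 1 - κ < s₀.re := hs₀
  apply DifferentiableAt.differentiableWithinAt
  set ε := (s₀.re + κ - 1) / 3 with hε
  have hεp : 0 < ε := by rw [hε]; linarith
  set R' := max R 1
  set C' := max C 0
  have hmeas : ∀ s : ℂ, AEStronglyMeasurable (fun t => (N t : ℂ) ^ (s - 1)) μ := fun s =>
    ((Complex.measurable_ofReal.comp hN).pow_const (s - 1)).aestronglyMeasurable
  have hbase : ∀ᵐ t ∂μ, ∀ s ∈ Metric.ball s₀ ε,
      ‖f t‖ * ‖(N t : ℂ) ^ (s - 1)‖ ≤ C' * N t ^ (κ + s.re - 1) := by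
    filter_upwards [hpos, hC] with t ht hCt s hs
    rw [Complex.norm_cpow_eq_rpow_re_of_pos ht]
    calc _ ≤ C' * N t ^ κ * N t ^ (s - 1).re := by
          gcongr
          exact hCt.trans (by gcongr; exact le_max_left _ _)
      _ = _ := by
        rw [mul_assoc, ← Real.rpow_add ht]
        congr 2
        simp; ring
  have hre : ∀ s ∈ Metric.ball s₀ ε, 2 * ε ≤ κ + s.re - 1 ∧ κ + s.re - 1 ≤ 4 * ε := by
    intro s hs
    have h1 : |(s - s₀).re| < ε := lt_of_le_of_lt (Complex.abs_re_le_norm _)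
      (by simpa [dist_eq_norm] using hs)
    rw [Complex.sub_re, abs_lt] at h1
    have : s₀.re + κ - 1 = 3 * ε := by rw [hε]; ring
    constructor <;> linarith
  have hI : Integrable (A.indicator fun _ => C' * R' ^ (3 * ε) : α → ℝ) μ :=
    (integrable_indicator_iff hA).mpr (integrableOn_const hAμ)
  have hI' : Integrable (A.indicator fun _ => C' * (2 * R' ^ (5 * ε) / ε) : α → ℝ) μ :=
    (integrable_indicator_iff hA).mpr (integrableOn_const hAμ)
  refine (hasDerivAt_integral_of_dominated_loc_of_deriv_le (𝕜 := ℂ) (μ := μ)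
    (F := fun s t => f t * (N t : ℂ) ^ (s - 1))
    (F' := fun s t => f t * ((N t : ℂ) ^ (s - 1) * Complex.log (N t)))
    (x₀ := s₀) (s := Metric.ball s₀ ε)
    (bound := A.indicator fun _ => C' * (2 * R' ^ (5 * ε) / ε))
    (Metric.ball_mem_nhds _ hεp) (Eventually.of_forall fun s => hf.mul (hmeas s)) ?_
    (hf.mul ((hmeas _).mul
      (Complex.measurable_log.comp (Complex.measurable_ofReal.comp hN)).aestronglyMeasurable))
    ?_ hI' ?_).2.differentiableAt
  · refine hI.mono' (hf.mul (hmeas _)) ?_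
    filter_upwards [hpos, hbase, hsupp] with t ht hb hsu
    rw [norm_mul]
    by_cases hft : f t = 0
    · rw [hft, norm_zero, zero_mul]
      exact Set.indicator_nonneg (fun _ _ => by positivity) _
    · obtain ⟨hA', hR'⟩ := hsu hft
      rw [Set.indicator_of_mem hA']
      refine (hb s₀ (Metric.mem_ball_self hεp)).trans ?_
      have : κ + s₀.re - 1 = 3 * ε := by rw [hε]; ring
      rw [this]
      gcongr
      exact hR'.trans (le_max_left _ _)
  · filter_upwards [hpos, hbase, hsupp] with t ht hb hsu s hs
    by_cases hft : f t = 0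
    · rw [hft, zero_mul, norm_zero]
      exact Set.indicator_nonneg (fun _ _ => by positivity) _
    · obtain ⟨hA', hR'⟩ := hsu hft
      rw [Set.indicator_of_mem hA', norm_mul, norm_mul, ← mul_assoc, ← Complex.ofReal_log ht.le,
        Complex.norm_real, Real.norm_eq_abs]
      obtain ⟨r1, r2⟩ := hre s hs
      calc _ ≤ C' * N t ^ (κ + s.re - 1) * |Real.log (N t)| := 
          mul_le_mul_of_nonneg_right (hb s hs) (abs_nonneg _)
        _ = C' * (|Real.log (N t)| * N t ^ (κ + s.re - 1)) := by ring
        _ ≤ _ := by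
          gcongr
          exact aux_log_bound ht (hR'.trans (le_max_left _ _)) (le_max_right _ _) hεp
            (by linarith) r2
  · filter_upwards [hpos] with t ht s hs
    have h1 : HasDerivAt (fun s : ℂ => (N t : ℂ) ^ (s - 1))
        ((N t : ℂ) ^ (s - 1) * Complex.log (N t) * 1) s :=
      ((hasDerivAt_id s).sub_const 1).const_cpow (Or.inl (by exact_mod_cast ht.ne'))
    rw [mul_one] at h1
    exact h1.const_mul _

end Holo

section Continuation
open MeasureTheory mixedEmbedding NumberField.InfinitePlace
open scoped Classical

variable {K : Type*} [Field K] [NumberField K]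

theorem aux_entire (ρ : ℝ) (Z : ℂ → ℂ) (γ : ℕ → ℝ)
    (hγ : ∀ s : ℂ, s ≠ 1 →
      HasSum (fun n : ℕ => (γ n : ℂ) * (s - 1) ^ n) (Z s - (ρ : ℂ) / (s - 1))) :
    Differentiable ℂ (fun s : ℂ => ∑' n : ℕ, (γ n : ℂ) * (s - 1) ^ n) := by
  intro s₀
  set R : ℝ := ‖s₀ - 1‖ + 1 with hR
  have hRp : 0 < R := by positivity
  have hsum := (hγ (1 + (R : ℂ)) (by
    intro h
    have : (R : ℂ) = 0 := by simpa using h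
    exact hRp.ne' (by exact_mod_cast this))).summable.norm
  have hd : DifferentiableOn ℂ (fun s : ℂ => ∑' n : ℕ, (γ n : ℂ) * (s - 1) ^ n)
      (Metric.ball 1 R) := by
    refine Complex.differentiableOn_tsum_of_summable_norm hsum (fun n => ?_) Metric.isOpen_ball ?_
    · exact (((differentiable_id.sub_const 1).pow n).const_mul _).differentiableOn
    · intro n s hs
      rw [norm_mul, norm_mul, norm_pow, norm_pow, add_sub_cancel_left, Complex.norm_real R,
        Real.norm_of_nonneg hRp.le]
      have : ‖s - 1‖ ≤ R := by
        have := Metric.mem_ball.mp hs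
        rw [dist_eq_norm] at this
        exact this.le
      gcongr
  refine hd.differentiableAt (Metric.isOpen_ball.mem_nhds ?_)
  rw [Metric.mem_ball, dist_eq_norm, hR]
  linarith

theorem aux_H_holo (J : Ideal (𝓞 K)) (hJ : J ≠ ⊥) (g : mixedSpace K → ℂ)
    (hg : ContDiff ℝ (⊤ : ℕ∞) g) (hs : HasCompactSupport g) (h0 : ∫ x, g x = 0) (hg0 : g 0 = 0)
    (κ : ℝ) :
    DifferentiableOn ℂ (fun s : ℂ => ∫ t in auxD K,
      (∑' x : 𝓞 K, if x ∈ J ∧ x ≠ 0 then g (mixedEmbedding K (x : K) * t) else 0) *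
        (mixedEmbedding.norm t : ℂ) ^ (s - 1)) {s | 1 - κ < s.re} := by
  have := aux_countable K
  obtain ⟨R, hR, hvan⟩ := aux_vanish J g hs
  obtain ⟨C, hC, hdec⟩ := aux_decay J hJ g hg hs h0 hg0 κ R
  obtain ⟨R1, hR1, hcone⟩ := aux_cone_bound K
  have hD : MeasurableSet (auxD K) := measurableSet_fundamentalCone K
  have hmem : ∀ᵐ t ∂((volume : Measure (mixedSpace K)).restrict (auxD K)), t ∈ auxD K :=
    ae_restrict_mem hD
  have hmeas : Measurable (fun t : mixedSpace K =>
      ∑' x : 𝓞 K, if x ∈ J ∧ x ≠ 0 then g (mixedEmbedding K (x : K) * t) else 0) := by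
    refine Measurable.tsum fun x => ?_
    split_ifs
    · exact (hg.continuous.comp (continuous_const.mul continuous_id)).measurable
    · exact measurable_const
  refine aux_holo _ _ _ (mixedEmbedding.continuous_norm K).measurable ?_
    hmeas.aestronglyMeasurable
    (Metric.closedBall 0 (R1 * R ^ ((Module.finrank ℚ K : ℝ)⁻¹))) Metric.isClosed_closedBall.measurableSet
    ?_ C κ R ?_ ?_
  · filter_upwards [hmem] with t ht using fundamentalCone.norm_pos_of_mem ht
  · refine ne_top_of_le_ne_top ?_ (Measure.restrict_apply_le _ _)
    exact (isCompact_closedBall _ _).measure_lt_top.ne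
  · filter_upwards [hmem] with t ht
    by_cases h : mixedEmbedding.norm t ≤ R
    · exact hdec t ht h
    · rw [hvan t (not_le.mp h), norm_zero]
      have := mixedEmbedding.norm_nonneg t
      positivity
  · filter_upwards [hmem] with t ht hne
    have h : mixedEmbedding.norm t ≤ R := by
      by_contra h
      exact hne (hvan t (not_le.mp h))
    refine ⟨?_, h⟩
    rw [mem_closedBall_zero_iff]
    refine (hcone t ht).trans ?_
    have := mixedEmbedding.norm_nonneg t
    gcongr

theorem aux_zero_of_test (ρ : ℝ) (Z : ℂ → ℂ) (γ : ℕ → ℝ)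
    (hZ : ∀ s : ℂ, 1 < s.re →
      HasSum (fun I : {I : Ideal (𝓞 K) // I ≠ ⊥} =>
        (Ideal.absNorm I.1 : ℂ) ^ (-s)) (Z s))
    (hγ : ∀ s : ℂ, s ≠ 1 →
      HasSum (fun n : ℕ => (γ n : ℂ) * (s - 1) ^ n) (Z s - (ρ : ℂ) / (s - 1)))
    (k : ℕ) (g : mixedSpace K → ℂ) (hg : ContDiff ℝ (⊤ : ℕ∞) g) (hgs : HasCompactSupport g)
    (hg0 : g 0 = 0) (a : mixedSpace K) (ha : 1 < mixedEmbedding.norm a)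
    (δ : ℝ) (hδ : 0 < δ)
    (hh : ∀ t, mixedEmbedding.norm t < δ →
      g (a * t) - (mixedEmbedding.norm a : ℂ) ^ (2 * k) * g t = 0)
    (hne : ∫ t, auxPhi (fun t => g (a * t) - (mixedEmbedding.norm a : ℂ) ^ (2 * k) * g t)
      (-(2 * k : ℕ)) t ≠ 0) : Z (-(2 * k : ℕ)) = 0 := by
  have ha0 : mixedEmbedding.norm a ≠ 0 := by positivity
  set q : ℝ := mixedEmbedding.norm a with hq
  have hqC : (q : ℂ) ≠ 0 := by exact_mod_cast ha0
  set h : mixedSpace K → ℂ := fun t => g (a * t) - (q : ℂ) ^ (2 * k) * g t with hh_def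
  let ga : mixedSpace K → ℂ := fun t => g (a * t)
  have hga : ContDiff ℝ (⊤ : ℕ∞) ga := hg.comp (auxMul a ha0).contDiff
  have hgas : HasCompactSupport ga := hgs.comp_homeomorph (auxMul a ha0).toHomeomorph
  let g' : mixedSpace K → ℂ := fun t => (q : ℂ) * ga t - g t
  have hg' : ContDiff ℝ (⊤ : ℕ∞) g' := (contDiff_const.mul hga).sub hg
  have hgs' : HasCompactSupport g' := (hgas.mul_left).sub hgs
  have hhs : HasCompactSupport h := hgas.sub (hgs.mul_left)
  have hhc : Continuous h := hga.continuous.sub (continuous_const.mul hg.continuous)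
  have hg0' : g' 0 = 0 := by simp [g', ga, hg0]
  have hi1 : Integrable ga := hga.continuous.integrable_of_hasCompactSupport hgas
  have hi2 : Integrable g := hg.continuous.integrable_of_hasCompactSupport hgs
  have hIntEq : ∫ x, g' x = 0 := by
    have e1 : ∫ x, ga x = (q⁻¹ : ℝ) • ∫ x, g x := aux_integral_mul a ha0 g
    simp only [g']
    rw [integral_sub (hi1.const_mul _) hi2, integral_const_mul, e1, Complex.real_smul,
      Complex.ofReal_inv, mul_inv_cancel_left₀ hqC, sub_self]
  obtain ⟨J, hJ, hun⟩ := aux_unfold_all (K := K) Z hZ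
  let H : ClassGroup (𝓞 K) → ℂ → ℂ := fun c s => ∫ t in auxD K,
      (∑' x : 𝓞 K, if x ∈ J c ∧ x ≠ 0 then g' (mixedEmbedding K (x : K) * t) else 0) *
        (mixedEmbedding.norm t : ℂ) ^ (s - 1)
  let P : ℂ → ℂ := fun s => ∑ c, (Ideal.absNorm (J c) : ℂ) ^ s * H c s
  let κ : ℝ := 2 * k + 2
  let U : Set ℂ := {s | 1 - κ < s.re}
  have hUo : IsOpen U := isOpen_lt continuous_const Complex.continuous_re
  have hUc : IsPreconnected U := (convex_halfSpace_re_gt _).isPreconnected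
  have hH : ∀ c, DifferentiableOn ℂ (H c) U := fun c =>
    aux_H_holo (J c) (hJ c) g' hg' hgs' hIntEq hg0' κ
  have hJ0 : ∀ c, (Ideal.absNorm (J c) : ℂ) ≠ 0 := fun c => by
    rw [Nat.cast_ne_zero, Ne, Ideal.absNorm_eq_zero_iff]; exact hJ c
  have hP : DifferentiableOn ℂ P U := by
    refine DifferentiableOn.fun_sum fun c _ => ?_
    exact (differentiable_id.const_cpow (Or.inl (hJ0 c))).differentiableOn.mul (hH c)
  let Mh : ℂ → ℂ := fun s => ∫ t, auxPhi h s t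
  have hMh : DifferentiableOn ℂ Mh U := by
    obtain ⟨B, hB⟩ := hhc.bounded_above_of_compact_support hhs
    obtain ⟨R, hR⟩ :=
      (hhs.isCompact.image (mixedEmbedding.continuous_norm K)).isBounded.exists_norm_le
    refine aux_holo volume h (fun t => mixedEmbedding.norm t)
      (mixedEmbedding.continuous_norm K).measurable ?_ hhc.aestronglyMeasurable (tsupport h)
      (isClosed_tsupport h).measurableSet hhs.isCompact.measure_lt_top.ne (B * δ ^ (-κ)) κ R ?_ ?_
    · filter_upwards [aux_norm_ae K] with t ht
      exact lt_of_le_of_ne (mixedEmbedding.norm_nonneg t) ht.symm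
    · refine Eventually.of_forall fun t => ?_
      have hB0 : 0 ≤ B := (norm_nonneg _).trans (hB 0)
      by_cases hlt : mixedEmbedding.norm t < δ
      · have : h t = 0 := hh t hlt
        rw [this, norm_zero]
        have := mixedEmbedding.norm_nonneg t
        positivity
      · refine (hB t).trans ?_
        rw [mul_assoc]
        refine le_mul_of_one_le_right hB0 ?_
        rw [Real.rpow_neg hδ.le, ← div_eq_inv_mul, one_le_div (Real.rpow_pos_of_pos hδ _)]
        exact Real.rpow_le_rpow hδ.le (not_lt.mp hlt) (by simp only [κ]; positivity)
    · refine Eventually.of_forall fun t ht => ⟨subset_tsupport h ht, ?_⟩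
      exact (le_abs_self _).trans (hR _ ⟨t, subset_tsupport h ht, rfl⟩)
  let F : ℂ → ℂ := fun s => ∑' n : ℕ, (γ n : ℂ) * (s - 1) ^ n
  have hF : Differentiable ℂ F := aux_entire ρ Z γ hγ
  have hFZ : ∀ s : ℂ, s ≠ 1 → (s - 1) * F s + ρ = (s - 1) * Z s := by
    intro s hs
    have h1 : s - 1 ≠ 0 := sub_ne_zero.mpr hs
    have : F s = Z s - (ρ : ℂ) / (s - 1) := (hγ s hs).tsum_eq
    rw [this]
    field_simp
    ring
  let W : ℂ := Units.torsionOrder K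
  have hW : W ≠ 0 := Nat.cast_ne_zero.mpr (Units.torsionOrder_ne_zero K)
  let Lf : ℂ → ℂ := fun s => (s - 1) * ((q : ℂ) ^ (-s) - (q : ℂ) ^ (2 * k)) * P s
  let Rf : ℂ → ℂ := fun s => W * ((s - 1) * F s + ρ) * ((q : ℂ) * (q : ℂ) ^ (-s) - 1) * Mh s
  have hqd : Differentiable ℂ fun s : ℂ => (q : ℂ) ^ (-s) :=
    differentiable_id.neg.const_cpow (Or.inl hqC)
  have hLf : DifferentiableOn ℂ Lf U :=
    (((differentiable_id.sub_const 1).mul (hqd.sub_const _)).differentiableOn).mul hP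
  have hRf : DifferentiableOn ℂ Rf U :=
    (((((differentiable_id.sub_const 1).mul hF).add_const _).const_mul W).mul
      ((hqd.const_mul _).sub_const 1)).differentiableOn.mul hMh
  have hkey : ∀ s : ℂ, 1 < s.re → Lf s = Rf s := by
    intro s hs
    have hs1 : s ≠ 1 := by rintro rfl; simp at hs
    have j1 : Integrable (auxPhi ga s) := auxPhi_integrable ga hga.continuous hgas s hs
    have j2 : Integrable (auxPhi g s) := auxPhi_integrable g hg.continuous hgs s hs
    have c1 : ∫ t, auxPhi ga s t = (q : ℂ) ^ (-s) * ∫ t, auxPhi g s t := auxPhi_change g s a ha0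
    have c2 : Mh s = ((q : ℂ) ^ (-s) - (q : ℂ) ^ (2 * k)) * ∫ t, auxPhi g s t := by
      have : ∀ t, auxPhi h s t = auxPhi ga s t - (q : ℂ) ^ (2 * k) * auxPhi g s t := fun t => by
        simp only [auxPhi, h, ga]; ring
      simp only [Mh, this]
      rw [integral_sub j1 (j2.const_mul _), integral_const_mul, c1]; ring
    have c3 : ∫ t, auxPhi g' s t = ((q : ℂ) * (q : ℂ) ^ (-s) - 1) * ∫ t, auxPhi g s t := by
      have : ∀ t, auxPhi g' s t = (q : ℂ) * auxPhi ga s t - auxPhi g s t := fun t => by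
        simp only [auxPhi, g']; ring
      simp only [this]
      rw [integral_sub (j1.const_mul _) j2, integral_const_mul, c1]; ring
    have c4 : P s = W * Z s * ∫ t, auxPhi g' s t := hun g' hg'.continuous hgs' s hs
    simp only [Lf, Rf]
    rw [c4, c2, c3, hFZ s hs1]
    ring
  have hEq : Set.EqOn Lf Rf U := by
    refine (hLf.analyticOnNhd hUo).eqOn_of_preconnected_of_eventuallyEq (hRf.analyticOnNhd hUo) hUc
      (z₀ := 2) ?_ ?_
    · show 1 - κ < (2 : ℂ).re
      simp only [κ, Complex.re_ofNat]
      have : (0 : ℝ) ≤ k := Nat.cast_nonneg k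
      linarith
    · have : {s : ℂ | 1 < s.re} ∈ nhds (2 : ℂ) :=
        (isOpen_lt continuous_const Complex.continuous_re).mem_nhds (by simp)
      filter_upwards [this] with s hs using hkey s hs
  have hz : (-(2 * k : ℕ) : ℂ) ∈ U := by
    show 1 - κ < (-((2 * k : ℕ) : ℂ)).re
    simp only [κ, Complex.neg_re, Complex.natCast_re]
    push_cast
    linarith
  have hfin := hEq hz
  have hs1 : (-(2 * k : ℕ) : ℂ) - 1 ≠ 0 := by
    have : (-(2 * k : ℕ) : ℂ) - 1 = -((2 * k + 1 : ℕ) : ℂ) := by push_cast; ring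
    rw [this, neg_ne_zero]
    exact Nat.cast_ne_zero.mpr (by omega)
  simp only [Lf, Rf] at hfin
  rw [hFZ _ (sub_ne_zero.mp hs1), neg_neg, Complex.cpow_natCast, sub_self, mul_zero, zero_mul] at hfin
  have hq1 : (q : ℂ) * (q : ℂ) ^ (2 * k) - 1 ≠ 0 := by
    rw [← pow_succ', sub_ne_zero]
    have : q ^ (2 * k + 1) ≠ 1 := (one_lt_pow₀ ha (by omega)).ne'
    exact_mod_cast this
  have := hfin.symm
  simp only [mul_eq_zero, hW, hs1, hq1, false_or, or_false] at this
  rcases this with h1 | h1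
  · exact h1
  · exact absurd h1 hne

end Continuation

section TestFunction
open MeasureTheory mixedEmbedding NumberField.InfinitePlace
open scoped Classical

variable {K : Type*} [Field K] [NumberField K]

theorem aux_place_smooth (w : InfinitePlace K) :
    ContDiff ℝ (⊤ : ℕ∞) (fun t : mixedSpace K => normAtPlace w t ^ 2) := by
  by_cases hw : IsReal w
  · simp_rw [normAtPlace_apply_of_isReal hw]
    have h : ContDiff ℝ (⊤ : ℕ∞) (fun t : mixedSpace K => t.1 ⟨w, hw⟩) :=
      (contDiff_apply ℝ ℝ (⟨w, hw⟩ : {w : InfinitePlace K // IsReal w})).comp contDiff_fst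
    exact h.norm_sq ℝ
  · have hw' := not_isReal_iff_isComplex.mp hw
    simp_rw [normAtPlace_apply_of_isComplex hw']
    have h : ContDiff ℝ (⊤ : ℕ∞) (fun t : mixedSpace K => t.2 ⟨w, hw'⟩) :=
      (contDiff_apply ℝ ℂ (⟨w, hw'⟩ : {w : InfinitePlace K // IsComplex w})).comp contDiff_snd
    exact h.norm_sq ℝ

theorem aux_smoothTransition_mono : Monotone Real.smoothTransition := by
  have hmono := Real.smoothTransition.monotone
  exact hmono

/-- One-variable bump, supported in `[1/2, 2]`. -/
noncomputable def auxEta (r : ℝ) : ℝ :=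
  Real.smoothTransition (2 - r) * Real.smoothTransition (r - 1 / 2)

/-- The product of the bumps at the places other than `w0`. -/
noncomputable def auxRest (w0 : InfinitePlace K) (t : mixedSpace K) : ℝ :=
  ∏ w ∈ Finset.univ.erase w0, auxEta (normAtPlace w t ^ 2)

/-- The real test function. -/
noncomputable def auxG (w0 : InfinitePlace K) (m : ℕ) (t : mixedSpace K) : ℝ :=
  (normAtPlace w0 t ^ 2) ^ m * Real.smoothTransition (2 - normAtPlace w0 t ^ 2) * auxRest w0 t

theorem auxEta_nonneg (r : ℝ) : 0 ≤ auxEta r :=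
  mul_nonneg (Real.smoothTransition.nonneg _) (Real.smoothTransition.nonneg _)

theorem auxEta_ne {r : ℝ} (h : auxEta r ≠ 0) : 1 / 2 < r ∧ r < 2 := by
  constructor
  · by_contra h1
    exact h (by rw [auxEta, Real.smoothTransition.zero_of_nonpos (x := r - 1 / 2) (by linarith),
      mul_zero])
  · by_contra h1
    exact h (by rw [auxEta, Real.smoothTransition.zero_of_nonpos (x := 2 - r) (by linarith),
      zero_mul])

theorem auxRest_nonneg (w0 : InfinitePlace K) (t : mixedSpace K) : 0 ≤ auxRest w0 t :=
  Finset.prod_nonneg fun _ _ => auxEta_nonneg _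

theorem auxRest_smooth (w0 : InfinitePlace K) : ContDiff ℝ (⊤ : ℕ∞) (auxRest w0) := by
  refine contDiff_prod fun w _ => ?_
  exact (Real.smoothTransition.contDiff.comp (contDiff_const.sub (aux_place_smooth w))).mul
    (Real.smoothTransition.contDiff.comp ((aux_place_smooth w).sub contDiff_const))

theorem auxG_smooth (w0 : InfinitePlace K) (m : ℕ) : ContDiff ℝ (⊤ : ℕ∞) (auxG w0 m) :=
  (((aux_place_smooth w0).pow m).mul
    (Real.smoothTransition.contDiff.comp (contDiff_const.sub (aux_place_smooth w0)))).mul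
    (auxRest_smooth w0)

theorem auxG_supp (w0 : InfinitePlace K) (m : ℕ) : HasCompactSupport (auxG w0 m) := by
  refine HasCompactSupport.intro (isCompact_closedBall (0 : mixedSpace K) 2) fun t ht => ?_
  by_contra hne
  refine ht ?_
  rw [mem_closedBall_zero_iff, norm_eq_sup'_normAtPlace, Finset.sup'_le_iff]
  intro w _
  have h2 : normAtPlace w t ^ 2 < 2 := by
    by_cases hw : w = w0
    · subst hw
      by_contra h1
      refine hne ?_
      rw [auxG, Real.smoothTransition.zero_of_nonpos (by linarith), mul_zero, zero_mul]
    · have h3 : auxRest w0 t ≠ 0 := right_ne_zero_of_mul hne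
      exact (auxEta_ne (Finset.prod_ne_zero_iff.mp h3 w
        (Finset.mem_erase.mpr ⟨hw, Finset.mem_univ _⟩))).2
  nlinarith [normAtPlace_nonneg w t]

/-- The scaling element: `2` at `w0` and `1` elsewhere. -/
noncomputable def auxA (w0 : InfinitePlace K) : mixedSpace K :=
  (fun w => if w.1 = w0 then 2 else 1, fun w => if w.1 = w0 then 2 else 1)

theorem auxA_place (w0 w : InfinitePlace K) :
    normAtPlace w (auxA w0) = if w = w0 then 2 else 1 := by
  by_cases hw : IsReal w
  · rw [normAtPlace_apply_of_isReal hw]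
    simp only [auxA]
    split_ifs <;> simp
  · rw [normAtPlace_apply_of_isComplex (not_isReal_iff_isComplex.mp hw)]
    simp only [auxA]
    split_ifs <;> simp

theorem auxA_norm (w0 : InfinitePlace K) : mixedEmbedding.norm (auxA w0) = 2 ^ w0.mult := by
  rw [mixedEmbedding.norm_apply, Finset.prod_eq_single w0]
  · rw [auxA_place, if_pos rfl]
  · intro w _ hw
    rw [auxA_place, if_neg hw, one_pow]
  · simp

theorem auxG_diff (w0 : InfinitePlace K) (k : ℕ) (t : mixedSpace K) :
    auxG w0 (k * w0.mult) (auxA w0 * t) -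
      (mixedEmbedding.norm (auxA w0)) ^ (2 * k) * auxG w0 (k * w0.mult) t =
    (4 * normAtPlace w0 t ^ 2) ^ (k * w0.mult) *
      (Real.smoothTransition (2 - 4 * normAtPlace w0 t ^ 2) -
        Real.smoothTransition (2 - normAtPlace w0 t ^ 2)) * auxRest w0 t := by
  have h1 : auxRest w0 (auxA w0 * t) = auxRest w0 t := by
    refine Finset.prod_congr rfl fun w hw => ?_
    rw [map_mul, auxA_place, if_neg (Finset.ne_of_mem_erase hw), one_mul]
  have h2 : normAtPlace w0 (auxA w0 * t) ^ 2 = 4 * normAtPlace w0 t ^ 2 := by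
    rw [map_mul, auxA_place, if_pos rfl]; ring
  have h3 : ((2 : ℝ) ^ w0.mult) ^ (2 * k) = 4 ^ (k * w0.mult) := by
    rw [← pow_mul, show (4 : ℝ) = 2 ^ 2 by norm_num, ← pow_mul]
    congr 1; ring
  rw [auxG, auxG, h1, h2, auxA_norm, h3, mul_pow]
  ring

theorem aux_trivial_zero (ρ : ℝ) (Z : ℂ → ℂ) (γ : ℕ → ℝ)
    (hZ : ∀ s : ℂ, 1 < s.re →
      HasSum (fun I : {I : Ideal (𝓞 K) // I ≠ ⊥} =>
        (Ideal.absNorm I.1 : ℂ) ^ (-s)) (Z s))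
    (hγ : ∀ s : ℂ, s ≠ 1 →
      HasSum (fun n : ℕ => (γ n : ℂ) * (s - 1) ^ n) (Z s - (ρ : ℂ) / (s - 1)))
    (k : ℕ) (hk : 0 < k) : Z (-(2 * k : ℕ)) = 0 := by
  obtain ⟨w0⟩ : Nonempty (InfinitePlace K) := inferInstance
  set m := k * w0.mult with hm
  have hm0 : m ≠ 0 := mul_ne_zero hk.ne' w0.mult_ne_zero
  let g : mixedSpace K → ℂ := fun t => (auxG w0 m t : ℂ)
  have hg : ContDiff ℝ (⊤ : ℕ∞) g := Complex.ofRealCLM.contDiff.comp (auxG_smooth w0 m)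
  have hgs : HasCompactSupport g := (auxG_supp w0 m).comp_left (g := ((↑) : ℝ → ℂ)) rfl
  have hg0 : g 0 = 0 := by simp [g, auxG, hm0]
  set a : mixedSpace K := auxA w0 with ha_def
  have ha : 1 < mixedEmbedding.norm a := by
    rw [ha_def, auxA_norm]
    exact one_lt_pow₀ (by norm_num) w0.mult_ne_zero
  have ha0 : mixedEmbedding.norm a ≠ 0 := by positivity
  let h0 : mixedSpace K → ℝ := fun t =>
    auxG w0 m (a * t) - (mixedEmbedding.norm a) ^ (2 * k) * auxG w0 m t
  have hh0 : ∀ t, h0 t = (4 * normAtPlace w0 t ^ 2) ^ m *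
      (Real.smoothTransition (2 - 4 * normAtPlace w0 t ^ 2) -
        Real.smoothTransition (2 - normAtPlace w0 t ^ 2)) * auxRest w0 t := auxG_diff w0 k
  have hcast : ∀ t, g (a * t) - (mixedEmbedding.norm a : ℂ) ^ (2 * k) * g t = (h0 t : ℂ) := by
    intro t; simp only [g, h0]; push_cast; ring
  let δ : ℝ := ∏ w : InfinitePlace K, (1 / 2 : ℝ) ^ w.mult
  have hδ : 0 < δ := Finset.prod_pos fun w _ => by positivity
  have hsmall : ∀ t, mixedEmbedding.norm t < δ → h0 t = 0 := by
    intro t ht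
    by_contra hne
    refine absurd ht (not_lt.mpr ?_)
    rw [mixedEmbedding.norm_apply]
    refine Finset.prod_le_prod (fun w _ => by positivity) fun w _ => ?_
    refine pow_le_pow_left₀ (by norm_num) ?_ _
    have h2 : 1 / 4 < normAtPlace w t ^ 2 := by
      rw [hh0] at hne
      by_cases hw : w = w0
      · subst hw
        by_contra h1
        refine hne ?_
        rw [Real.smoothTransition.one_of_one_le (by linarith),
          Real.smoothTransition.one_of_one_le (by linarith), sub_self, mul_zero, zero_mul]
      · have h3 : auxRest w0 t ≠ 0 := right_ne_zero_of_mul hne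
        have := (auxEta_ne (Finset.prod_ne_zero_iff.mp h3 w
          (Finset.mem_erase.mpr ⟨hw, Finset.mem_univ _⟩))).1
        linarith
    nlinarith [normAtPlace_nonneg w t]
  refine aux_zero_of_test ρ Z γ hZ hγ k g hg hgs hg0 a ha δ hδ ?_ ?_
  · intro t ht
    rw [hcast, hsmall t ht, Complex.ofReal_zero]
  · simp_rw [hcast]
    let φ : mixedSpace K → ℝ := fun t =>
      -h0 t * ((max (mixedEmbedding.norm t) δ) ^ (2 * k + 1))⁻¹
    have hφ : ∀ t, auxPhi (fun t => (h0 t : ℂ)) (-(2 * k : ℕ)) t = ((-φ t : ℝ) : ℂ) := by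
      intro t
      simp only [auxPhi, φ]
      by_cases hlt : mixedEmbedding.norm t < δ
      · simp [hsmall t hlt]
      · rw [max_eq_left (not_lt.mp hlt),
          show -((2 * k : ℕ) : ℂ) - 1 = -((2 * k + 1 : ℕ) : ℂ) by push_cast; ring,
          Complex.cpow_neg, Complex.cpow_natCast]
        push_cast
        ring
    have hh0c : Continuous h0 :=
      ((auxG_smooth w0 m).continuous.comp (continuous_const.mul continuous_id)).sub
        (continuous_const.mul (auxG_smooth w0 m).continuous)
    have hh0s : HasCompactSupport h0 :=
      ((auxG_supp w0 m).comp_homeomorph (auxMul a ha0).toHomeomorph).sub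
        ((auxG_supp w0 m).mul_left)
    have hφc : Continuous φ := by
      refine hh0c.neg.mul (Continuous.inv₀ ?_ ?_)
      · exact ((mixedEmbedding.continuous_norm K).max continuous_const).pow _
      · intro t
        have : 0 < max (mixedEmbedding.norm t) δ := lt_max_of_lt_right hδ
        positivity
    have hφs : HasCompactSupport φ := hh0s.neg.mul_right
    have hφ0 : 0 ≤ φ := by
      intro t
      have h1 : h0 t ≤ 0 := by
        rw [hh0]
        refine mul_nonpos_of_nonpos_of_nonneg (mul_nonpos_of_nonneg_of_nonpos (by positivity) ?_)
          (auxRest_nonneg _ _)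
        rw [sub_nonpos]
        exact aux_smoothTransition_mono (by nlinarith [sq_nonneg (normAtPlace w0 t)])
      have h2 : 0 < max (mixedEmbedding.norm t) δ := lt_max_of_lt_right hδ
      exact mul_nonneg (by linarith) (by positivity)
    have hφ1 : φ 1 ≠ 0 := by
      have h2 : 0 < max (mixedEmbedding.norm (1 : mixedSpace K)) δ := lt_max_of_lt_right hδ
      refine mul_ne_zero ?_ (by positivity)
      rw [neg_ne_zero, hh0]
      refine mul_ne_zero (mul_ne_zero (by simp) ?_) ?_
      · rw [map_one, Real.smoothTransition.zero_of_nonpos (by norm_num),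
          Real.smoothTransition.one_of_one_le (by norm_num)]
        norm_num
      · refine Finset.prod_ne_zero_iff.mpr fun w _ => ?_
        rw [map_one, auxEta]
        exact (mul_pos (Real.smoothTransition.pos_of_pos (by norm_num))
          (Real.smoothTransition.pos_of_pos (by norm_num))).ne'
    have hpos : 0 < ∫ t, φ t :=
      hφc.integral_pos_of_hasCompactSupport_nonneg_nonzero hφs hφ0 hφ1
    simp_rw [hφ]
    rw [integral_complex_ofReal, integral_neg]
    exact_mod_cast (neg_neg_of_pos hpos).ne

end TestFunction

theorem aux_poly_bound (c : ℕ → ℝ) (N : ℕ) (x v : ℕ → ℝ) (L : ℝ) (hx : Tendsto x atTop atTop)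
    (hc : ∀ n, N ≤ n → 0 ≤ c n) (hs : ∀ k, HasSum (fun n => c n * x k ^ n) (v k))
    (hv : Tendsto v atTop (nhds L)) : (∀ k, v k = L) ∧ c 0 = L := by
  classical
  -- enlarge `N`
  wlog hN : 1 ≤ N generalizing N
  · exact this (N + 1) (fun n hn => hc n (by omega)) (by omega)
  have hzero : ∀ n, N ≤ n → c n = 0 := by
    intro m hm
    by_contra hne
    have hpos : 0 < c m := lt_of_le_of_ne (hc m hm) (Ne.symm hne)
    let Q : Polynomial ℝ := ∑ n ∈ Finset.range N, Polynomial.monomial n (c n)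
    let P : Polynomial ℝ := Polynomial.monomial m (c m) + Q
    have hQd : Q.degree < (m : WithBot ℕ) := by
      refine lt_of_le_of_lt (Polynomial.degree_sum_le _ _) ?_
      refine (Finset.sup_lt_iff (WithBot.bot_lt_coe m)).2 ?_
      intro n hn
      refine lt_of_le_of_lt (Polynomial.degree_monomial_le _ _) ?_
      have := Finset.mem_range.1 hn
      exact WithBot.coe_lt_coe.2 (by omega : n < m)
    have hmd : (Polynomial.monomial m (c m)).degree = m := Polynomial.degree_monomial _ hne
    have hPd : P.degree = m := by
      rw [Polynomial.degree_add_eq_left_of_degree_lt (by rw [hmd]; exact hQd), hmd]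
    have hPl : P.leadingCoeff = c m := by
      rw [Polynomial.leadingCoeff_add_of_degree_lt' (by rw [hmd]; exact hQd)]
      simp
    have ht := P.tendsto_atTop_of_leadingCoeff_nonneg (by rw [hPd]; exact_mod_cast (by omega : 0 < m))
      (by rw [hPl]; exact hpos.le)
    have ht2 := ht.comp hx
    have hle : ∀ᶠ k in atTop, P.eval (x k) ≤ v k := by
      filter_upwards [hx.eventually_ge_atTop 0] with k hk
      have h1 := sum_le_hasSum (insert m (Finset.range N)) (fun n hn => by
        simp only [Finset.mem_insert, Finset.mem_range, not_or, not_lt] at hn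
        exact mul_nonneg (hc n hn.2) (pow_nonneg hk n)) (hs k)
      rw [Finset.sum_insert (by simp; omega)] at h1
      simpa [P, Q, Polynomial.eval_finsetSum] using h1
    have := tendsto_atTop_mono' _ hle ht2
    exact not_tendsto_nhds_of_tendsto_atTop this L hv
  let Q : Polynomial ℝ := ∑ n ∈ Finset.range N, Polynomial.monomial n (c n)
  have hQv : ∀ k, v k = Q.eval (x k) := by
    intro k
    have h1 : HasSum (fun n => c n * x k ^ n) (∑ n ∈ Finset.range N, c n * x k ^ n) :=
      hasSum_sum_of_ne_finset_zero (fun n hn => by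
        rw [hzero n (by simpa using hn), zero_mul])
    rw [(hs k).unique h1]
    simp [Q, Polynomial.eval_finsetSum]
  have hdeg : Q.degree ≤ 0 := by
    by_contra hd
    have h1 := (Q.abs_tendsto_atTop (not_le.1 hd)).comp hx
    have h2 : Tendsto (fun k => |v k|) atTop (nhds |L|) := hv.abs
    refine not_tendsto_nhds_of_tendsto_atTop h1 |L| (h2.congr fun k => ?_)
    simp [hQv]
  have hQc : Q = Polynomial.C (c 0) := by
    rw [Polynomial.eq_C_of_degree_le_zero hdeg]
    congr 1
    simp only [Q, Polynomial.finsetSum_coeff, Polynomial.coeff_monomial]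
    rw [Finset.sum_ite_eq' (Finset.range N) 0]
    simp; omega
  have hvc : ∀ k, v k = c 0 := fun k => by rw [hQv, hQc]; simp
  have : c 0 = L := by
    refine tendsto_nhds_unique ?_ hv
    rw [show v = fun _ => c 0 from funext hvc]; exact tendsto_const_nhds
  exact ⟨fun k => by rw [hvc, this], this⟩

theorem aux_Z_real (K : Type*) [Field K] [NumberField K] (Z : ℂ → ℂ)
    (hZ : ∀ s : ℂ, 1 < s.re →
      HasSum (fun I : {I : Ideal (𝓞 K) // I ≠ ⊥} =>
        (Ideal.absNorm I.1 : ℂ) ^ (-s)) (Z s)) (x : ℝ) (hx : 1 < x) :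
    HasSum (fun I : {I : Ideal (𝓞 K) // I ≠ ⊥} => (Ideal.absNorm I.1 : ℝ) ^ (-x)) (Z x).re := by
  have := Complex.hasSum_re (hZ x (by simpa using hx))
  convert this using 2 with I
  rw [← Complex.ofReal_natCast, ← Complex.ofReal_neg, ← Complex.ofReal_cpow (by positivity)]
  simp

theorem aux_Z_gt (K : Type*) [Field K] [NumberField K] (Z : ℂ → ℂ)
    (hZ : ∀ s : ℂ, 1 < s.re →
      HasSum (fun I : {I : Ideal (𝓞 K) // I ≠ ⊥} =>
        (Ideal.absNorm I.1 : ℂ) ^ (-s)) (Z s)) (x : ℝ) (hx : 1 < x) : 1 < (Z x).re := by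
  classical
  have h := aux_Z_real K Z hZ x hx
  let A : {I : Ideal (𝓞 K) // I ≠ ⊥} := ⟨⊤, top_ne_bot⟩
  let B : {I : Ideal (𝓞 K) // I ≠ ⊥} := ⟨Ideal.span {2}, by simp⟩
  have hAB : A ≠ B := by
    intro h
    have h2 : (⊤ : Ideal (𝓞 K)) = Ideal.span {2} := congrArg Subtype.val h
    have h3 : Ideal.absNorm (Ideal.span {(2 : 𝓞 K)}) = 1 := by rw [← h2]; simp
    rw [Ideal.absNorm_span_singleton] at h3
    have h4 : (Algebra.norm ℤ (2 : 𝓞 K)) = 2 ^ Module.finrank ℤ (𝓞 K) := by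
      have := Algebra.norm_algebraMap (R := ℤ) (S := 𝓞 K) 2
      simpa using this
    rw [h4, Int.natAbs_pow, RingOfIntegers.rank] at h3
    have : Module.finrank ℚ K ≠ 0 := Module.finrank_pos.ne'
    have h5 := Nat.pow_eq_one.1 h3
    simp [this] at h5
  have h1 := sum_le_hasSum {A, B} (fun I _ => by positivity) h
  rw [Finset.sum_pair hAB] at h1
  have hB : 0 < (Ideal.absNorm B.1 : ℝ) ^ (-x) := by
    have : Ideal.absNorm B.1 ≠ 0 := by rw [Ne, Ideal.absNorm_eq_zero_iff]; exact B.2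
    positivity
  have hA : (Ideal.absNorm A.1 : ℝ) ^ (-x) = 1 := by simp [A]
  linarith

theorem aux_Z_lim (K : Type*) [Field K] [NumberField K] (Z : ℂ → ℂ)
    (hZ : ∀ s : ℂ, 1 < s.re →
      HasSum (fun I : {I : Ideal (𝓞 K) // I ≠ ⊥} =>
        (Ideal.absNorm I.1 : ℂ) ^ (-s)) (Z s)) :
    Tendsto (fun x : ℝ => (Z x).re) atTop (nhds 1) := by
  classical
  let A : {I : Ideal (𝓞 K) // I ≠ ⊥} := ⟨⊤, top_ne_bot⟩
  have h2 := (aux_Z_real K Z hZ 2 (by norm_num)).summable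
  have key := tendsto_tsum_of_dominated_convergence (𝓕 := (atTop : Filter ℝ))
    (f := fun (x : ℝ) (I : {I : Ideal (𝓞 K) // I ≠ ⊥}) => (Ideal.absNorm I.1 : ℝ) ^ (-x))
    (g := fun I => if I = A then 1 else 0) h2 (fun I => ?_) ?_
  · rw [tsum_ite_eq A (fun _ => (1:ℝ))] at key
    refine key.congr' ?_
    filter_upwards [eventually_gt_atTop 1] with x hx
    exact (aux_Z_real K Z hZ x hx).tsum_eq
  · by_cases hI : I = A
    · simp [hI, A]
    · simp only [hI, if_false]
      have h0 : Ideal.absNorm I.1 ≠ 0 := by rw [Ne, Ideal.absNorm_eq_zero_iff]; exact I.2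
      have h1 : Ideal.absNorm I.1 ≠ 1 := by
        rw [Ne, Ideal.absNorm_eq_one_iff]; exact fun h => hI (Subtype.ext h)
      have h3 : (1 : ℝ) < Ideal.absNorm I.1 := by exact_mod_cast (by omega : 1 < Ideal.absNorm I.1)
      have := (tendsto_rpow_atBot_of_base_gt_one _ h3).comp tendsto_neg_atTop_atBot
      exact this
  · filter_upwards [eventually_ge_atTop 2] with x hx I
    have h0 : Ideal.absNorm I.1 ≠ 0 := by rw [Ne, Ideal.absNorm_eq_zero_iff]; exact I.2
    have h3 : (1 : ℝ) ≤ Ideal.absNorm I.1 := by exact_mod_cast (by omega : 1 ≤ Ideal.absNorm I.1)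
    rw [Real.norm_of_nonneg (by positivity)]
    exact Real.rpow_le_rpow_of_exponent_le h3 (by linarith)

theorem aux_final (K : Type*) [Field K] [NumberField K]
    (ρ : ℝ) (Z : ℂ → ℂ) (γ : ℕ → ℝ)
    (hZ : ∀ s : ℂ, 1 < s.re →
      HasSum (fun I : {I : Ideal (𝓞 K) // I ≠ ⊥} =>
        (Ideal.absNorm I.1 : ℂ) ^ (-s)) (Z s))
    (hγ : ∀ s : ℂ, s ≠ 1 →
      HasSum (fun n : ℕ => (γ n : ℂ) * (s - 1) ^ n) (Z s - (ρ : ℂ) / (s - 1)))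
    (hzero : ∀ k : ℕ, 0 < k → Z (-(2 * k : ℕ)) = 0) :
    {n : ℕ | 0 < n ∧ 0 < γ (2 * n)}.Infinite ∧
    {n : ℕ | 0 < n ∧ γ (2 * n) < 0}.Infinite ∧
    {n : ℕ | 0 < n ∧ 0 < γ (2 * n - 1)}.Infinite ∧
    {n : ℕ | 0 < n ∧ γ (2 * n - 1) < 0}.Infinite := by
  let x : ℕ → ℝ := fun k => 2 * (k + 1) + 1
  have hxpos : ∀ k, 0 < x k := fun k => by positivity
  have hx : Tendsto x atTop atTop := by
    refine tendsto_atTop_mono (fun k => ?_) tendsto_natCast_atTop_atTop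
    simp only [x]; linarith [(Nat.cast_nonneg k : (0:ℝ) ≤ k)]
  let a : ℕ → ℝ := fun k => (Z ((1 + x k : ℝ) : ℂ)).re
  have ha : Tendsto a atTop (nhds 1) :=
    (aux_Z_lim K Z hZ).comp (tendsto_atTop_add_const_left _ 1 hx)
  have ha1 : ∀ k, 1 < a k := fun k => aux_Z_gt K Z hZ _ (by linarith [hxpos k])
  have hp : ∀ k, HasSum (fun n => γ n * x k ^ n) (a k - ρ / x k) := by
    intro k
    have h := Complex.hasSum_re (hγ ((1 + x k : ℝ) : ℂ) (by
      intro h; have := Complex.ofReal_eq_one.1 h; linarith [hxpos k]))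
    convert h using 1
    · ext n
      rw [show ((1 + x k : ℝ) : ℂ) - 1 = (x k : ℂ) by push_cast; ring]
      rw [← Complex.ofReal_pow, ← Complex.ofReal_mul, Complex.ofReal_re]
    · rw [show ((1 + x k : ℝ) : ℂ) - 1 = (x k : ℂ) by push_cast; ring]
      rw [← Complex.ofReal_div, Complex.sub_re, Complex.ofReal_re]
  have hm : ∀ k, HasSum (fun n => γ n * (- x k) ^ n) (ρ / x k) := by
    intro k
    have h := Complex.hasSum_re (hγ (-(2 * (k + 1) : ℕ)) (by
      intro h
      have := congrArg Complex.re h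
      simp at this
      linarith [(Nat.cast_nonneg k : (0:ℝ) ≤ k)]))
    rw [hzero (k + 1) (by omega)] at h
    have e : (-((2 * (k + 1) : ℕ) : ℂ)) - 1 = ((-x k : ℝ) : ℂ) := by simp only [x]; push_cast; ring
    rw [e] at h
    convert h using 1
    · ext n
      rw [← Complex.ofReal_pow, ← Complex.ofReal_mul, Complex.ofReal_re]
    · rw [zero_sub, ← Complex.ofReal_div, ← Complex.ofReal_neg, Complex.ofReal_re, div_neg, neg_neg]
  -- even part
  let ce : ℕ → ℝ := fun n => if Even n then 2 * γ n else 0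
  let co : ℕ → ℝ := fun n => if Even n then 0 else 2 * γ n
  have hE : ∀ k, HasSum (fun n => ce n * x k ^ n) (a k) := by
    intro k
    convert (hp k).add (hm k) using 1
    · ext n
      by_cases h : Even n
      · simp [ce, h, h.neg_pow]; ring
      · simp [ce, h, (Nat.not_even_iff_odd.1 h).neg_pow]
    · ring
  have hO : ∀ k, HasSum (fun n => co n * x k ^ n) (a k - 2 * ρ / x k) := by
    intro k
    have e : (fun n => co n * x k ^ n) = fun n => γ n * x k ^ n - γ n * (- x k) ^ n := by
      ext n
      by_cases h : Even n
      · simp [co, h, h.neg_pow]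
      · simp [co, h, (Nat.not_even_iff_odd.1 h).neg_pow]; ring
    rw [e, show a k - 2 * ρ / x k = a k - ρ / x k - ρ / x k by ring]
    exact (hp k).sub (hm k)
  have hOl : Tendsto (fun k => a k - 2 * ρ / x k) atTop (nhds 1) := by
    have := ha.sub (hx.const_div_atTop (2 * ρ))
    simpa using this
  have key : ∀ (σ : ℝ) (N : ℕ), σ ^ 2 = 1 → (∀ n, N ≤ n → 0 ≤ σ * ce n) → False := by
    intro σ N hσ h
    have h1 := aux_poly_bound (fun n => σ * ce n) N x (fun k => σ * a k) (σ * 1) hx h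
      (fun k => by simpa [mul_assoc] using (hE k).mul_left σ) (ha.const_mul σ)
    have h2 := h1.1 0
    have h0 : σ ≠ 0 := by rintro rfl; norm_num at hσ
    have h3 := mul_left_cancel₀ h0 h2
    linarith [ha1 0]
  have keyo : ∀ (σ : ℝ) (N : ℕ), σ ^ 2 = 1 → (∀ n, N ≤ n → 0 ≤ σ * co n) → False := by
    intro σ N hσ h
    have h1 := aux_poly_bound (fun n => σ * co n) N x (fun k => σ * (a k - 2 * ρ / x k)) (σ * 1) hx h
      (fun k => by simpa [mul_assoc] using (hO k).mul_left σ) (hOl.const_mul σ)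
    have h2 := h1.2
    simp [co] at h2
    rw [← h2] at hσ
    norm_num at hσ
  refine ⟨?_, ?_, ?_, ?_⟩
  · intro hf
    obtain ⟨B, hB⟩ := hf.bddAbove
    refine key (-1) (2 * B + 2) (by norm_num) fun n hn => ?_
    by_cases h : Even n
    · obtain ⟨m, rfl⟩ := h
      have : ¬ (0 < γ (m + m)) := fun hh => by
        have := hB (show m ∈ _ from ⟨by omega, by rwa [two_mul]⟩)
        omega
      simp [ce]; linarith
    · simp [ce, h]
  · intro hf
    obtain ⟨B, hB⟩ := hf.bddAbove
    refine key 1 (2 * B + 2) (by norm_num) fun n hn => ?_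
    by_cases h : Even n
    · obtain ⟨m, rfl⟩ := h
      have : ¬ (γ (m + m) < 0) := fun hh => by
        have := hB (show m ∈ _ from ⟨by omega, by rwa [two_mul]⟩)
        omega
      simp [ce]; linarith
    · simp [ce, h]
  · intro hf
    obtain ⟨B, hB⟩ := hf.bddAbove
    refine keyo (-1) (2 * B + 2) (by norm_num) fun n hn => ?_
    by_cases h : Even n
    · simp [co, h]
    · obtain ⟨m, rfl⟩ := Nat.not_even_iff_odd.1 h
      have : ¬ (0 < γ (2 * m + 1)) := fun hh => by
        have := hB (show m + 1 ∈ _ from ⟨by omega, by rwa [show 2 * (m + 1) - 1 = 2 * m + 1 by omega]⟩)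
        omega
      simp [co, h]; linarith
  · intro hf
    obtain ⟨B, hB⟩ := hf.bddAbove
    refine keyo 1 (2 * B + 2) (by norm_num) fun n hn => ?_
    by_cases h : Even n
    · simp [co, h]
    · obtain ⟨m, rfl⟩ := Nat.not_even_iff_odd.1 h
      have : ¬ (γ (2 * m + 1) < 0) := fun hh => by
        have := hB (show m + 1 ∈ _ from ⟨by omega, by rwa [show 2 * (m + 1) - 1 = 2 * m + 1 by omega]⟩)
        omega
      simp [co, h]; linarith

/-- Each of `γ_{2n}(K) > 0`, `γ_{2n}(K) < 0`, `γ_{2n−1}(K) > 0`, `γ_{2n−1}(K) < 0` holds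
for infinitely many positive integers `n`. -/
theorem dedekind_stieltjes_even_odd_sign_changes (K : Type*) [Field K] [NumberField K]
    (ρ : ℝ) (Z : ℂ → ℂ) (γ : ℕ → ℝ)
    (hZ : ∀ s : ℂ, 1 < s.re →
      HasSum (fun I : {I : Ideal (𝓞 K) // I ≠ ⊥} =>
        (Ideal.absNorm I.1 : ℂ) ^ (-s)) (Z s))
    (hγ : ∀ s : ℂ, s ≠ 1 →
      HasSum (fun n : ℕ => (γ n : ℂ) * (s - 1) ^ n) (Z s - (ρ : ℂ) / (s - 1))) :
    {n : ℕ | 0 < n ∧ 0 < γ (2 * n)}.Infinite ∧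
    {n : ℕ | 0 < n ∧ γ (2 * n) < 0}.Infinite ∧
    {n : ℕ | 0 < n ∧ 0 < γ (2 * n - 1)}.Infinite ∧
    {n : ℕ | 0 < n ∧ γ (2 * n - 1) < 0}.Infinite := by
  exact aux_final K ρ Z γ hZ hγ (aux_trivial_zero ρ Z γ hZ hγ)
end
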